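/- There exists a constant C (depending only on the bowtie graph F₂) such that the following holds: every graph R on k vertices with minimum degree δ(R) ≤ (3/5)k contains a family of at least 2δ(R) - k - C pairwise vertex-disjoint copies of F₂. -/

import Mathlib

open Finset

/-- The bowtie graph `F₂`: two triangles `0,1,2` and `0,3,4` sharing the vertex `0`. -/
def Bowtie : SimpleGraph (Fin 5) :=
  SimpleGraph.fromRel (fun a b => a = 0 ∨ (a = 1 ∧ b = 2) ∨ (a = 3 ∧ b = 4))


namespace BT

/-- pairs which must be adjacent in a piece -/
def ppairs {α : Type} : List α → List (α × α)
  | [c, a, b, d, e] => [(c, a), (c, b), (c, d), (c, e), (a, b), (d, e)]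
  | [a, b, c, d] => [(a, b), (c, d), (a, c), (a, d), (b, c)]
  | [x, y] => [(x, y)]
  | _ => []

def lenok (n : ℕ) : Bool := n == 5 || n == 4 || n == 2
def wl (n : ℕ) : ℕ := if n = 5 then 7 else n
def hl (n : ℕ) : ℕ := if n = 4 then 1 else 0

def okp (fx : List (ℕ × ℕ)) (w g t : ℕ) (p : ℕ × ℕ) : Bool :=
  fx.contains (min p.1 p.2, max p.1 p.2) ||
    (decide (min p.1 p.2 < 5) && decide (5 ≤ max p.1 p.2) && decide (max p.1 p.2 < 5 + 3 * w) &&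
      (if (max p.1 p.2 - 5) / w = g then
        t.testBit (min p.1 p.2 + 5 * ((max p.1 p.2 - 5) % w)) else true))

def chk (fx : List (ℕ × ℕ)) (w g t : ℕ) (P : List (List ℕ)) : Bool :=
  P.all fun p => (ppairs p).all (okp fx w g t)

def allL {α : Type} (p : α → Bool) (l : List α) : Bool :=
  List.rec true (fun a _ ih => cond (p a) ih false) l

def anyL {α : Type} (p : α → Bool) (l : List α) : Bool :=
  List.rec false (fun a _ ih => cond (p a) true ih) l

def bsl (t : ℕ) (l : List ℕ) : ℕ :=
  List.rec 0 (fun m _ ih => Nat.add (Nat.mul 2 ih) (cond (Nat.beq (Nat.land m t) m) 1 0)) l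

def pchk (fx : List (ℕ × ℕ)) (w g : ℕ) : List ℕ → List (List (List ℕ)) → Bool
  | [], [] => true
  | m :: r, P :: r' => chk fx w g m P && pchk fx w g r r'
  | _, _ => false

def tri (C0 C1 C2 : List ℕ) : Bool :=
  allL (fun a => allL (fun b => allL (fun c =>
    Nat.ble 1 (Nat.land (Nat.land a b) c)) C2) C1) C0

def pc (n : ℕ) : ℕ → ℕ :=
  Nat.rec (fun _ => 0) (fun _ ih t => Nat.add (Nat.mod t 2) (ih (Nat.div t 2))) n

def enc (l : List Bool) : ℕ :=
  List.rec 0 (fun b _ ih => Nat.add (Nat.mul 2 ih) (cond b 1 0)) l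

def bits (w : ℕ) (f : ℕ → ℕ → Bool) : List Bool :=
  (List.range w).flatMap fun j => (List.range 5).map fun i => f i j

def tb (t i : ℕ) : Bool := Nat.beq (Nat.mod (Nat.shiftRight t i) 2) 1

def pm (w : ℕ) (al s : List ℕ) (t : ℕ) : ℕ :=
  enc (bits w fun i j => tb t (al.getD i 0 + 5 * s.getD j 0))

def cov (w n : ℕ) (auts S : List (List ℕ)) (nd C : List ℕ) : Bool :=
  allL (fun t => cond (Nat.ble n (pc (5 * w) t))
    (anyL (fun al => anyL (fun s => anyL (fun c =>
      Nat.beq (Nat.land c (bsl (pm w al s t) nd)) c) C) S) auts) true) (List.range (2 ^ (5 * w)))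

def fxB : List (ℕ × ℕ) := [(0, 1), (0, 2), (0, 3), (0, 4), (1, 2), (3, 4)]
def fxE : List (ℕ × ℕ) := fxB ++ [(5, 6), (7, 8), (9, 10)]
def id5 : List (List ℕ) := [[0, 1, 2, 3, 4]]
def auts8 : List (List ℕ) := [[0, 1, 2, 3, 4], [0, 2, 1, 3, 4], [0, 1, 2, 4, 3], [0, 2, 1, 4, 3],
  [0, 3, 4, 1, 2], [0, 4, 3, 1, 2], [0, 3, 4, 2, 1], [0, 4, 3, 2, 1]]
def sw2 : List (List ℕ) := [[0, 1], [1, 0]]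
def id2 : List (List ℕ) := [[0, 1]]
def id1 : List (List ℕ) := [[0]]


def patB : List (List (List ℕ)) :=
  [[[0, 1, 2, 3, 5], [4, 6]], [[0, 1, 2, 4, 5], [3, 6]], [[0, 1, 6, 3, 4], [2, 5]], [[0, 3], [1,
  5], [2, 6], [4, 7]], [[0, 4], [1, 5], [2, 6], [3, 7]], [[0, 3], [1, 5], [2, 7], [4, 6]], [[0, 4],
  [1, 7], [2, 5], [3, 6]], [[0, 1], [2, 5], [3, 6], [4, 7]], [[0, 3], [1, 6], [2, 7], [4, 5]]]
def ndBx0 : List ℕ :=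
  [9, 17, 4, 2, 2, 2, 4, 4, 16]
def cvBx0 : List ℕ :=
  [253, 315, 455, 508]
def ndBx1 : List ℕ :=
  [16, 8, 3, 4, 4, 16, 8, 8, 2]
def cvBx1 : List ℕ :=
  [57, 218, 227, 284, 293, 454]
def ndBx2 : List ℕ :=
  [0, 0, 0, 16, 8, 4, 2, 16, 4]
def cvBx2 : List ℕ :=
  [87, 159, 207, 311, 359, 431]

def pat1 : List (List (List ℕ)) :=
  [[[3, 0, 4, 9, 10], [1, 2, 5, 6], [7, 8]], [[4, 0, 3, 9, 10], [1, 2, 5, 6], [7, 8]], [[0, 3, 4,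
  9, 10], [1, 2, 5, 6], [7, 8]], [[1, 0, 2, 5, 6], [3, 4, 7, 8], [9, 10]], [[0, 3, 4, 7, 8], [1, 2,
  6, 5], [9, 10]], [[1, 0, 2, 5, 6], [4, 3, 7, 8], [9, 10]], [[1, 2, 6, 7, 8], [0, 4, 3, 5], [9,
  10]], [[2, 1, 6, 7, 8], [3, 0, 4, 5], [9, 10]], [[0, 3, 4, 7, 8], [1, 2, 5, 6], [9, 10]], [[0, 1,
  5, 3, 4], [2, 7, 8, 9, 10]], [[1, 2, 5, 9, 10], [0, 4, 3, 6], [7, 8]], [[1, 0, 2, 7, 8], [3, 4,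
  5, 6], [9, 10]], [[0, 2, 5, 3, 4], [1, 7, 8, 9, 10]], [[1, 2, 10, 5, 6], [3, 0, 4, 9], [7, 8]],
  [[0, 2, 9, 3, 4], [1, 5, 6, 7, 8]], [[0, 2, 10, 3, 4], [1, 5, 6, 7, 8]], [[0, 2, 7, 3, 4], [1, 5,
  6, 9, 10]], [[0, 2, 8, 3, 4], [1, 5, 6, 9, 10]], [[2, 0, 1, 7, 8], [3, 4, 5, 6], [9, 10]], [[0,
  2, 6, 3, 4], [1, 7, 8, 9, 10]]]
def nd1x0 : List ℕ :=
  [70, 70, 70, 66, 194, 66, 201, 216, 70, 3, 294, 280, 5, 66, 66, 66, 66, 66, 280, 160]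
def cv1x0 : List ℕ :=
  [258863, 518591, 518904, 519471, 778687, 779000]
def nd1x1 : List ℕ :=
  [0, 0, 0, 280, 33, 536, 66, 132, 33, 132, 0, 66, 66, 0, 66, 66, 5, 160, 132, 66]
def cv1x1 : List ℕ :=
  [9231, 9255, 75031, 140567, 337543, 403079, 588871]
def nd1x2 : List ℕ :=
  [264, 528, 33, 0, 0, 0, 0, 0, 0, 132, 66, 0, 66, 216, 5, 160, 66, 66, 0, 66]
def cv1x2 : List ℕ :=
  [264697, 264698, 281084, 281592, 297468, 297976, 990712]

def pat2 : List (List (List ℕ)) :=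
  [[[1, 0, 2, 5, 6], [3, 4, 7, 9, 10]], [[1, 0, 2, 5, 6], [4, 3, 7, 9, 10]], [[0, 3, 4, 9, 10], [1,
  2, 7, 5, 6]], [[0, 3, 4, 7, 8], [1, 2, 9, 5, 6]], [[0, 2, 7, 3, 4], [1, 5, 6, 9, 10]], [[0, 2, 9,
  3, 4], [1, 5, 6, 7, 8]], [[1, 2, 10, 5, 6], [4, 0, 3, 7, 8]], [[0, 1, 5, 3, 4], [2, 7, 8, 9,
  10]], [[1, 2, 8, 5, 6], [4, 0, 7, 3, 9]], [[1, 2, 10, 5, 6], [3, 0, 4, 7, 8]], [[1, 2, 7, 5, 6],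
  [3, 0, 4, 9, 10]], [[0, 2, 8, 3, 4], [1, 5, 6, 9, 10]], [[1, 2, 9, 5, 6], [3, 0, 4, 7, 8]], [[2,
  7, 8, 9, 10], [5, 1, 6, 3, 4]], [[0, 2, 10, 3, 4], [1, 5, 6, 7, 8]]]
def nd2x0 : List ℕ :=
  [66, 66, 66, 66, 66, 66, 66, 3, 66, 66, 66, 66, 66, 90, 66]
def cv2x0 : List ℕ :=
  [24575, 32639]
def nd2x1 : List ℕ :=
  [24, 24, 6, 33, 5, 66, 528, 132, 209, 264, 6, 160, 264, 132, 66]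
def cv2x1 : List ℕ :=
  [91, 2123, 4635, 4675, 6667, 8659, 9431, 10435, 10648, 11420, 13203, 13975, 14979, 16491, 16739,
  17468, 17511, 18531, 18728, 21035, 21283, 22055, 23075, 26036, 27812, 30388]
def nd2x2 : List ℕ :=
  [264, 528, 33, 6, 66, 5, 192, 132, 24, 192, 264, 66, 6, 132, 160]
def cv2x2 : List ℕ :=
  [294, 1283, 1317, 2326, 2898, 3349, 3921, 6204, 6426, 7449, 9186, 10209, 12714, 13737, 15096,
  16646, 17669, 19028, 25316, 25538, 26561, 28844, 29066, 30089, 31448]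

def pat4 : List (List (List ℕ)) :=
  [[[3, 0, 4, 9, 10], [5, 1, 6, 7, 8]], [[0, 3, 4, 9, 10], [5, 1, 6, 7, 8]], [[4, 0, 3, 9, 10], [5,
  1, 6, 7, 8]], [[0, 2, 10, 3, 4], [5, 1, 6, 7, 8]], [[0, 2, 9, 3, 4], [5, 1, 6, 7, 8]], [[1, 0, 2,
  9, 10], [5, 3, 6, 7, 8]], [[0, 1, 2, 4, 9], [5, 3, 6, 7, 8]], [[1, 0, 2, 9, 10], [5, 4, 8, 6,
  7]], [[1, 0, 2, 9, 10], [7, 3, 6, 5, 8]], [[2, 1, 6, 9, 10], [5, 0, 3, 7, 8]], [[0, 2, 6, 3, 4],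
  [1, 5, 8, 9, 10]], [[3, 0, 4, 9, 10], [6, 1, 2, 5, 7]], [[0, 2, 5, 3, 4], [1, 6, 7, 9, 10]], [[0,
  2, 7, 3, 4], [1, 5, 6, 9, 10]], [[0, 1, 2, 4, 10], [5, 3, 6, 7, 8]], [[0, 2, 8, 3, 4], [1, 5, 6,
  9, 10]], [[1, 0, 2, 9, 10], [5, 3, 8, 6, 7]], [[1, 0, 2, 9, 10], [6, 3, 4, 5, 7]]]
def nd4x0 : List ℕ :=
  [66, 66, 66, 66, 66, 264, 264, 16, 256, 201, 162, 192, 69, 66, 264, 66, 8, 768]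
def cv4x0 : List ℕ :=
  [44447, 45471, 48415, 84960, 109727, 110751, 114207, 123391, 126335, 127359, 175391, 178463,
  256383]
def nd4x1 : List ℕ :=
  [0, 0, 0, 0, 0, 0, 0, 512, 8, 0, 64, 0, 2, 5, 0, 160, 256, 0]
def cv4x1 : List ℕ :=
  [151551, 154623, 155391, 155519, 158719, 159487, 159615, 162559, 162687, 163455, 183295, 184063,
  184191, 187135, 187263, 188031, 191231, 191359, 192127, 195199, 216063, 216831, 216959, 219903,
  220031, 220799, 223999, 224127, 224895, 227967, 248575, 248703, 249471, 252543, 256639]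
def nd4x2 : List ℕ :=
  [264, 33, 528, 160, 5, 66, 17, 66, 66, 132, 66, 264, 66, 66, 544, 66, 66, 66]
def cv4x2 : List ℕ :=
  [68, 74, 82, 516, 520, 592, 2049, 16388, 243104]

def pat5 : List (List (List ℕ)) :=
  [[[1, 0, 2, 5, 6], [7, 4, 10, 8, 9]], [[1, 0, 2, 5, 6], [9, 3, 8, 7, 10]], [[1, 0, 2, 5, 6], [7,
  3, 10, 8, 9]], [[1, 0, 2, 5, 6], [9, 4, 8, 7, 10]], [[0, 1, 5, 3, 4], [9, 2, 8, 7, 10]], [[3, 0,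
  4, 5, 6], [9, 1, 8, 7, 10]], [[5, 1, 6, 3, 4], [7, 0, 10, 8, 9]], [[0, 1, 6, 3, 4], [7, 2, 10, 8,
  9]], [[0, 3, 4, 8, 9], [1, 5, 6, 7, 10]], [[3, 0, 4, 5, 6], [7, 2, 8, 9, 10]], [[0, 2, 5, 3, 4],
  [9, 1, 8, 7, 10]], [[3, 0, 4, 5, 6], [9, 2, 10, 7, 8]], [[0, 2, 5, 3, 4], [7, 1, 10, 8, 9]], [[5,
  1, 2, 3, 6], [7, 0, 8, 9, 10]], [[0, 1, 2, 3, 6], [7, 4, 8, 9, 10]], [[0, 1, 2, 3, 6], [9, 4, 10,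
  7, 8]], [[0, 1, 2, 5, 6], [7, 3, 4, 8, 9]], [[0, 1, 2, 5, 6], [8, 3, 4, 7, 9]], [[0, 1, 2, 4, 5],
  [9, 3, 10, 7, 8]], [[0, 1, 5, 3, 4], [7, 2, 8, 9, 10]], [[0, 1, 5, 3, 4], [9, 2, 10, 7, 8]], [[0,
  3, 4, 5, 6], [7, 1, 2, 8, 9]], [[0, 3, 4, 5, 6], [8, 1, 2, 7, 9]], [[0, 1, 8, 3, 4], [2, 5, 6, 7,
  9]], [[0, 2, 8, 3, 4], [1, 5, 6, 7, 9]]]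
def nd5x0 : List ℕ :=
  [66, 66, 66, 66, 3, 264, 90, 96, 66, 264, 5, 264, 5, 270, 288, 288, 33, 33, 17, 3, 3, 33, 33,
  132, 66]
def cv5x0 : List ℕ :=
  [25152511, 25176943, 33292223, 33494495, 33543583]
def nd5x1 : List ℕ :=
  [16, 256, 8, 512, 128, 64, 1, 4, 34, 132, 64, 0, 2, 33, 528, 0, 24, 768, 0, 132, 0, 6, 192, 100,
  162]
def cv5x1 : List ℕ :=
  [1359203, 1359206, 1359212, 1375593, 1412327, 1415255, 1416295, 1416487, 1419351, 1419463,
  1420391, 1423687, 1424741, 1428717, 1431645, 1432685, 1432877, 1435741, 1435853, 1436781,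
  1440077, 1477870, 1480798, 1481838, 1482030, 1484894, 1485006, 1485934, 1489230, 1490282,
  1494251, 1497179, 1498219, 1498411, 1501275, 1501387, 1502315, 1505611, 1558559, 1558671,
  1559599, 1562703, 1562895, 1566799, 1878739, 1878742, 1878748, 1895129, 1936023, 1944277,
  1952413, 2001566, 2009818, 2017947, 3448035, 3448038, 3448044, 3455427, 3455430, 3455436,
  3464425, 3471817, 3512519, 3512711, 3513511, 3513573, 3520965, 3528909, 3529101, 3529901,
  3578062, 3578254, 3579054, 3579114, 3586506, 3594443, 3594635, 3595435, 3971795, 3971798,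
  3971804, 3988185, 4037333, 4102874, 5545075, 5545078, 5545084, 5549171, 5549174, 5549180,
  5561465, 5565561, 5606455, 5610613, 5614709, 5622845, 5671998, 5676154, 5680250, 5688379,
  6065907, 6065910, 6065916, 6082297, 6131445, 6196986, 8167091, 8167094, 8167100, 8167153,
  8167154, 8167156, 8167160, 8183481, 8232629, 8298170, 9743587, 9743590, 9743596, 9759977,
  9800871, 9809125, 9817261, 9866414, 9874666, 9882795, 11836835, 11836838, 11836844, 11845089,
  11845090, 11845092, 11845096, 11853225, 11902373, 11967914, 14454451, 14454454, 14454460,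
  14462705, 14462706, 14462708, 14462712, 14470841, 14519989, 14585530, 18135379, 18135382,
  18135388, 18151769, 18192663, 18200917, 18209053, 18258206, 18266458, 18274587, 20749203,
  20749206, 20749212, 20757457, 20757458, 20757460, 20757464, 20765593, 20814741, 20880282,
  22322483, 22322486, 22322492, 22330737, 22330738, 22330740, 22330744, 22338873, 22388021,
  22453562, 33333169, 33333170, 33333172, 33333176, 33341424]
def nd5x2 : List ℕ :=
  [512, 8, 256, 16, 4, 2, 32, 128, 65, 0, 2, 132, 64, 0, 0, 528, 0, 0, 264, 0, 132, 0, 0, 4, 2]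
def cv5x2 : List ℕ :=
  [7041987, 7041989, 7041994, 7041996, 7070411, 7070413, 7074635, 7074637, 7074699, 7074701,
  7074761, 7299783, 7299790, 7304007, 7304014, 7304071, 7304078, 7304134, 7332431, 7332495,
  7336719, 15430483, 15430485, 15430490, 15430492, 15458907, 15458909, 15463195, 15463197,
  15463257, 15688279, 15688286, 15692567, 15692574, 15692630, 15720991, 16476883, 16476885,
  16476890, 16476892, 16481171, 16481173, 16481178, 16481180, 16481233, 16481234, 16481236,
  16481240, 16509595, 16509597, 16509657, 16513945, 16738967, 16738974, 16739030, 16743318,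
  23815907, 23815909, 23815914, 23815916, 23820131, 23820133, 23820138, 23820140, 23820195,
  23820197, 23820202, 23820204, 23820257, 23820258, 23820260, 23820264, 23848555, 23848557,
  23848619, 23848621, 23848681, 23852843, 23852845, 23852905, 23852969, 24077927, 24077934,
  24077991, 24077998, 24078054, 24082215, 24082222, 24082278, 24082342, 24110639, 32204403,
  32204405, 32204410, 32204412, 32208691, 32208693, 32208698, 32208700, 32208753, 32208754,
  32208756, 32208760, 32237115, 32237117, 32237177, 32241465, 32466487, 32466494, 32466550,
  32470838, 33255091, 33255093, 33255098, 33255100, 33255153, 33255154, 33255156, 33255160,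
  33259441, 33259442, 33259444, 33259448, 33259504, 33287865, 33517238]


def fx4 : List (ℕ × ℕ) := fxE ++ [(5, 7), (5, 8), (6, 7)]
def fx5 : List (ℕ × ℕ) := fxE ++ [(7, 9), (7, 10), (8, 9)]
theorem pBx0 : pchk fxB 1 0 ndBx0 patB = true := by decide +kernel
theorem cBx0 : cov 1 4 id5 id1 ndBx0 cvBx0 = true := by decide +kernel
theorem pBx1 : pchk fxB 1 1 ndBx1 patB = true := by decide +kernel
theorem cBx1 : cov 1 3 id5 id1 ndBx1 cvBx1 = true := by decide +kernel
theorem pBx2 : pchk fxB 1 2 ndBx2 patB = true := by decide +kernel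
theorem cBx2 : cov 1 3 id5 id1 ndBx2 cvBx2 = true := by decide +kernel
theorem tB : tri cvBx0 cvBx1 cvBx2 = true := by decide +kernel
theorem p1x0 : pchk fxE 2 0 nd1x0 pat1 = true := by decide +kernel
theorem c1x0 : cov 2 7 auts8 sw2 nd1x0 cv1x0 = true := by decide +kernel
theorem p1x1 : pchk fxE 2 1 nd1x1 pat1 = true := by decide +kernel
theorem c1x1 : cov 2 6 id5 sw2 nd1x1 cv1x1 = true := by decide +kernel
theorem p1x2 : pchk fxE 2 2 nd1x2 pat1 = true := by decide +kernel
theorem c1x2 : cov 2 6 id5 sw2 nd1x2 cv1x2 = true := by decide +kernel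
theorem t1 : tri cv1x0 cv1x1 cv1x2 = true := by decide +kernel
theorem p2x0 : pchk fxE 2 0 nd2x0 pat2 = true := by decide +kernel
theorem c2x0 : cov 2 7 auts8 sw2 nd2x0 cv2x0 = true := by decide +kernel
theorem p2x1 : pchk fxE 2 1 nd2x1 pat2 = true := by decide +kernel
theorem c2x1 : cov 2 7 id5 sw2 nd2x1 cv2x1 = true := by decide +kernel
theorem p2x2 : pchk fxE 2 2 nd2x2 pat2 = true := by decide +kernel
theorem c2x2 : cov 2 7 id5 sw2 nd2x2 cv2x2 = true := by decide +kernel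
theorem t2 : tri cv2x0 cv2x1 cv2x2 = true := by decide +kernel
theorem p4x0 : pchk fx4 2 0 nd4x0 pat4 = true := by decide +kernel
theorem c4x0 : cov 2 7 auts8 id2 nd4x0 cv4x0 = true := by decide +kernel
theorem p4x1 : pchk fx4 2 1 nd4x1 pat4 = true := by decide +kernel
theorem c4x1 : cov 2 6 id5 id2 nd4x1 cv4x1 = true := by decide +kernel
theorem p4x2 : pchk fx4 2 2 nd4x2 pat4 = true := by decide +kernel
theorem c4x2 : cov 2 6 id5 sw2 nd4x2 cv4x2 = true := by decide +kernel
theorem t4 : tri cv4x0 cv4x1 cv4x2 = true := by decide +kernel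
theorem p5x0 : pchk fx5 2 0 nd5x0 pat5 = true := by decide +kernel
theorem c5x0 : cov 2 8 auts8 sw2 nd5x0 cv5x0 = true := by decide +kernel
theorem p5x1 : pchk fx5 2 1 nd5x1 pat5 = true := by decide +kernel
theorem c5x1 : cov 2 6 id5 id2 nd5x1 cv5x1 = true := by decide +kernel
theorem p5x2 : pchk fx5 2 2 nd5x2 pat5 = true := by decide +kernel
theorem c5x2 : cov 2 6 id5 id2 nd5x2 cv5x2 = true := by decide +kernel
theorem t5 : tri cv5x0 cv5x1 cv5x2 = true := by decide +kernel


theorem allL_iff {α : Type} (p : α → Bool) (l : List α) :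
    allL p l = true ↔ ∀ x ∈ l, p x = true := by
  induction l with
  | nil => simp [allL]
  | cons a l ih =>
    have : allL p (a :: l) = cond (p a) (allL p l) false := rfl
    rw [this]
    cases h : p a <;> simp [h, ih]

theorem anyL_iff {α : Type} (p : α → Bool) (l : List α) :
    anyL p l = true ↔ ∃ x ∈ l, p x = true := by
  induction l with
  | nil => simp [anyL]
  | cons a l ih =>
    have : anyL p (a :: l) = cond (p a) true (anyL p l) := rfl
    rw [this]
    cases h : p a <;> simp [h, ih]

theorem enc_cons (b : Bool) (l : List Bool) : enc (b :: l) = 2 * enc l + b.toNat := by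
  cases b <;> rfl

theorem testBit_two (n : ℕ) (b : Bool) (i : ℕ) :
    (2 * n + b.toNat).testBit i = if i = 0 then b else n.testBit (i - 1) := by
  cases i with
  | zero => cases b <;> simp [Nat.testBit_zero]
  | succ i =>
    rw [Nat.testBit_succ]
    have : (2 * n + b.toNat) / 2 = n := by cases b <;> simp <;> omega
    simp [this]

theorem enc_testBit (l : List Bool) (i : ℕ) : (enc l).testBit i = l.getD i false := by
  induction l generalizing i with
  | nil => simp [enc]
  | cons b l ih =>
    rw [enc_cons, testBit_two]
    cases i with
    | zero => simp
    | succ i => simp [ih]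

theorem enc_lt (l : List Bool) : enc l < 2 ^ l.length := by
  induction l with
  | nil => simp [enc]
  | cons b l ih =>
    rw [enc_cons, List.length_cons, pow_succ]
    cases b <;> simp <;> omega

theorem pc_enc (l : List Bool) : pc l.length (enc l) = (l.map Bool.toNat).sum := by
  induction l with
  | nil => rfl
  | cons b l ih =>
    have h1 : pc (b :: l).length (enc (b :: l)) =
      (enc (b :: l)) % 2 + pc l.length (enc (b :: l) / 2) := rfl
    have h2 : enc (b :: l) % 2 = b.toNat := by
      rw [enc_cons]; cases b <;> simp <;> omega
    have h3 : enc (b :: l) / 2 = enc l := by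
      rw [enc_cons]; cases b <;> simp <;> omega
    rw [h1, h2, h3, ih]; simp

theorem land_beq {c b i : ℕ} (h : Nat.beq (Nat.land c b) c = true) (hi : c.testBit i = true) :
    b.testBit i = true := by
  have h' : c &&& b = c := Nat.eq_of_beq_eq_true h
  rw [← h', Nat.testBit_and] at hi
  simp at hi
  exact hi.2

theorem tb_eq (t i : ℕ) : tb t i = t.testBit i := by
  have h : tb t i = Nat.beq ((t >>> i) % 2) 1 := rfl
  rw [h, Nat.shiftRight_eq_div_pow, Nat.testBit_eq_decide_div_mod_eq]
  rcases Nat.mod_two_eq_zero_or_one (t / 2 ^ i) with h | h <;> rw [h] <;> rfl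

theorem bsl_sound (fx : List (ℕ × ℕ)) (w g t : ℕ) :
    ∀ (nd : List ℕ) (pats : List (List (List ℕ))), pchk fx w g nd pats = true → ∀ i,
    (bsl t nd).testBit i = true → ∃ P m, pats[i]? = some P ∧ chk fx w g m P = true ∧
      ∀ k, m.testBit k = true → t.testBit k = true := by
  intro nd
  induction nd with
  | nil => intro pats _ i hi; simp [bsl] at hi
  | cons m r ih =>
    intro pats hp i hi
    cases pats with
    | nil => simp [pchk] at hp
    | cons P r' =>
      simp only [pchk, Bool.and_eq_true] at hp
      have e : bsl t (m :: r) = 2 * bsl t r + (Nat.beq (Nat.land m t) m).toNat := by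
        have : bsl t (m :: r) = 2 * bsl t r + (cond (Nat.beq (Nat.land m t) m) 1 0) := rfl
        rw [this]; cases Nat.beq (Nat.land m t) m <;> rfl
      rw [e, testBit_two] at hi
      cases i with
      | zero =>
        simp only [↓reduceIte] at hi
        exact ⟨P, m, by simp, hp.1, fun k hk => land_beq hi hk⟩
      | succ i =>
        simp at hi
        obtain ⟨Q, m', h1, h2⟩ := ih r' hp.2 i hi
        exact ⟨Q, m', by simpa using h1, h2⟩

theorem bits_get (w : ℕ) (hw : w = 1 ∨ w = 2) (f : ℕ → ℕ → Bool) (i j : ℕ) (hi : i < 5)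
    (hj : j < w) : (enc (bits w f)).testBit (i + 5 * j) = f i j := by
  rw [enc_testBit]
  rcases hw with rfl | rfl
  · interval_cases j; interval_cases i <;> rfl
  · interval_cases j <;> interval_cases i <;> rfl

theorem bits_len (w : ℕ) (f : ℕ → ℕ → Bool) : (bits w f).length = 5 * w := by
  simp [bits, mul_comm]

def fsum (w : ℕ) (f : ℕ → ℕ → Bool) : ℕ :=
  ((List.range w).map fun j => ((List.range 5).map fun i => (f i j).toNat).sum).sum

theorem bits_sum (w : ℕ) (hw : w = 1 ∨ w = 2) (f : ℕ → ℕ → Bool) :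
    ((bits w f).map Bool.toNat).sum = fsum w f := by
  rcases hw with rfl | rfl <;> simp [bits, fsum, List.range_succ] <;> omega

/-- consequence of a cover check -/
theorem cov_sound (fx : List (ℕ × ℕ)) (w n g : ℕ) (hw : w = 1 ∨ w = 2) (auts S : List (List ℕ))
    (nd C : List ℕ) (pats : List (List (List ℕ))) (hp : pchk fx w g nd pats = true)
    (hc : cov w n auts S nd C = true) (hA : ∀ al ∈ auts, ∀ i < 5, al.getD i 0 < 5)
    (hS : ∀ s ∈ S, ∀ j < w, s.getD j 0 < w)
    (f : ℕ → ℕ → Bool) (hf : n ≤ fsum w f) :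
    ∃ al ∈ auts, ∃ s ∈ S, ∃ c ∈ C, ∀ i, c.testBit i = true →
      ∃ P m, pats[i]? = some P ∧ chk fx w g m P = true ∧
        ∀ i < 5, ∀ j < w, m.testBit (i + 5 * j) = true → f (al.getD i 0) (s.getD j 0) = true := by
  unfold cov at hc
  rw [allL_iff] at hc
  have h1 := hc (enc (bits w f)) (by
    rw [List.mem_range, ← bits_len w f]; exact enc_lt _)
  have h2 : Nat.ble n (pc (5 * w) (enc (bits w f))) = true := by
    rw [← bits_len w f, pc_enc, bits_sum w hw]
    exact Nat.ble_eq_true_of_le hf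
  rw [h2, cond_true] at h1
  simp only [anyL_iff] at h1
  obtain ⟨al, hal, s, hs, c, hcC, hb⟩ := h1
  refine ⟨al, hal, s, hs, c, hcC, fun i hi => ?_⟩
  obtain ⟨P, m, hP, hm, hk⟩ := bsl_sound fx w g _ nd pats hp i (land_beq hb hi)
  refine ⟨P, m, hP, hm, fun i hi j hj hb => ?_⟩
  have h3 := hk _ hb
  unfold pm at h3
  rw [bits_get w hw _ i j hi hj, tb_eq, bits_get w hw _ _ _ (hA al hal i hi) (hS s hs j hj)] at h3
  exact h3


def piF (w : ℕ) (al s0 s1 s2 : List ℕ) (i : ℕ) : ℕ :=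
  if i < 5 then al.getD i 0 else if i < 5 + w then 5 + s0.getD (i - 5) 0
  else if i < 5 + 2 * w then 5 + w + s1.getD (i - 5 - w) 0
  else 5 + 2 * w + s2.getD (i - 5 - 2 * w) 0

def symc (fx : List (ℕ × ℕ)) (w : ℕ) (auts S0 S1 S2 : List (List ℕ)) : Prop :=
  ∀ al ∈ auts, ∀ s0 ∈ S0, ∀ s1 ∈ S1, ∀ s2 ∈ S2,
    ((List.range (5 + 3 * w)).map (piF w al s0 s1 s2)).Nodup ∧
    (∀ i ∈ List.range (5 + 3 * w), piF w al s0 s1 s2 i < 5 + 3 * w) ∧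
    ∀ q ∈ fx, (min (piF w al s0 s1 s2 q.1) (piF w al s0 s1 s2 q.2),
      max (piF w al s0 s1 s2 q.1) (piF w al s0 s1 s2 q.2)) ∈ fx

instance (fx : List (ℕ × ℕ)) (w : ℕ) (auts S0 S1 S2 : List (List ℕ)) :
    Decidable (symc fx w auts S0 S1 S2) := by unfold symc; infer_instance

theorem symB : symc fxB 1 id5 id1 id1 id1 := by decide +kernel
theorem sym1 : symc fxE 2 auts8 sw2 sw2 sw2 := by decide +kernel
theorem sym4 : symc fx4 2 auts8 id2 id2 sw2 := by decide +kernel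
theorem sym5 : symc fx5 2 auts8 sw2 id2 id2 := by decide +kernel

theorem fsum_perm (w : ℕ) (al : List ℕ) (h : al.Perm (List.range 5)) (F : ℕ → ℕ → Bool) :
    fsum w (fun i j => F (al.getD i 0) j) = fsum w F := by
  unfold fsum
  congr 1
  apply List.map_congr_left
  intro j _
  have hl : al.length = 5 := by simpa using h.length_eq
  have e : (List.range 5).map (fun i => (F (al.getD i 0) j).toNat) =
      al.map (fun i => (F i j).toNat) := by
    apply List.ext_getElem
    · simp [hl]
    · intro n h1 h2
      have : n < al.length := by simpa using h2
      simp only [List.getElem_map, List.getElem_range]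
      rw [List.getD_eq_getElem _ _ this]
  rw [e]
  exact (h.map _).sum_eq

theorem okp_cases {fx : List (ℕ × ℕ)} {w g t : ℕ} {p : ℕ × ℕ} (h : okp fx w g t p = true) :
    (min p.1 p.2, max p.1 p.2) ∈ fx ∨ (min p.1 p.2 < 5 ∧ 5 ≤ max p.1 p.2 ∧
      max p.1 p.2 < 5 + 3 * w ∧ ((max p.1 p.2 - 5) / w = g →
        t.testBit (min p.1 p.2 + 5 * ((max p.1 p.2 - 5) % w)) = true)) := by
  unfold okp at h
  rw [Bool.or_eq_true] at h
  rcases h with h | h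
  · left; simpa using h
  · right
    simp only [Bool.and_eq_true, decide_eq_true_eq] at h
    refine ⟨h.1.1.1, h.1.1.2, h.1.2, fun e => ?_⟩
    have := h.2
    rwa [if_pos e] at this

theorem gen {fx : List (ℕ × ℕ)} {w : ℕ} (hw : w = 1 ∨ w = 2) {n0 n1 n2 : ℕ}
    {auts S0 S1 S2 : List (List ℕ)} {nd0 nd1 nd2 C0 C1 C2 : List ℕ}
    {pats : List (List (List ℕ))}
    (p0 : pchk fx w 0 nd0 pats = true) (p1 : pchk fx w 1 nd1 pats = true)
    (p2 : pchk fx w 2 nd2 pats = true)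
    (c0 : cov w n0 auts S0 nd0 C0 = true) (c1 : cov w n1 id5 S1 nd1 C1 = true)
    (c2 : cov w n2 id5 S2 nd2 C2 = true) (ht : tri C0 C1 C2 = true)
    (hsy : symc fx w auts S0 S1 S2)
    (hA : ∀ al ∈ auts, al.Perm (List.range 5))
    (hS0 : ∀ s ∈ S0, ∀ j < w, s.getD j 0 < w)
    (hS1 : ∀ s ∈ S1, ∀ j < w, s.getD j 0 < w)
    (hS2 : ∀ s ∈ S2, ∀ j < w, s.getD j 0 < w)
    (A : ℕ → ℕ → Bool) (hA' : ∀ i j, A i j = A j i) (hfx : ∀ q ∈ fx, A q.1 q.2 = true)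
    (h0 : n0 ≤ fsum w (fun i j => A i (5 + j)))
    (h1 : n1 ≤ fsum w (fun i j => A i (5 + w + j)))
    (h2 : n2 ≤ fsum w (fun i j => A i (5 + 2 * w + j))) :
    ∃ P ∈ pats, ∃ f : ℕ → ℕ, (∀ i < 5 + 3 * w, f i < 5 + 3 * w) ∧
      (∀ i < 5 + 3 * w, ∀ j < 5 + 3 * w, f i = f j → i = j) ∧
      ∀ p ∈ P, ∀ q ∈ ppairs p, A (f q.1) (f q.2) = true := by
  have hAl : ∀ al ∈ auts, ∀ i < 5, al.getD i 0 < 5 := by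
    intro al hal i hi
    have hl : al.length = 5 := by simpa using (hA al hal).length_eq
    rw [List.getD_eq_getElem _ _ (by omega)]
    have := (hA al hal).subset (List.getElem_mem (l := al) (n := i) (by omega))
    simpa using this
  have hid : ∀ al ∈ id5, ∀ i < 5, al.getD i 0 = i := by
    intro al hal i hi
    simp [id5] at hal; subst hal
    interval_cases i <;> rfl
  have hid' : ∀ al ∈ id5, ∀ i < 5, al.getD i 0 < 5 := by
    intro al hal i hi; rw [hid al hal i hi]; exact hi
  obtain ⟨al, hal, s0, hs0, a, ha, H0⟩ := cov_sound fx w n0 0 hw auts S0 nd0 C0 pats p0 c0 hAl hS0 _ h0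
  rw [← fsum_perm w al (hA al hal)] at h1 h2
  obtain ⟨i1, hi1, s1, hs1, b, hb, H1⟩ := cov_sound fx w n1 1 hw id5 S1 nd1 C1 pats p1 c1 hid' hS1 _ h1
  obtain ⟨i2, hi2, s2, hs2, c, hc, H2⟩ := cov_sound fx w n2 2 hw id5 S2 nd2 C2 pats p2 c2 hid' hS2 _ h2
  have hne : (a &&& b) &&& c ≠ 0 := by
    unfold tri at ht
    simp only [allL_iff] at ht
    have := Nat.le_of_ble_eq_true (ht a ha b hb c hc)
    change 1 ≤ (a &&& b) &&& c at this
    omega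
  obtain ⟨k, hk⟩ := Nat.exists_testBit_of_ne_zero hne
  simp only [Nat.testBit_and, Bool.and_eq_true] at hk
  obtain ⟨P, m0, hP, k0, B0⟩ := H0 k hk.1.1
  obtain ⟨P1, m1, hP1, k1, B1⟩ := H1 k hk.1.2
  obtain ⟨P2, m2, hP2, k2, B2⟩ := H2 k hk.2
  rw [hP] at hP1 hP2
  obtain rfl := Option.some.inj hP1
  obtain rfl := Option.some.inj hP2
  obtain ⟨y1, y2, y3⟩ := hsy al hal s0 hs0 s1 hs1 s2 hs2
  refine ⟨P, List.mem_of_getElem? hP, piF w al s0 s1 s2, fun i hi => y2 i (by simpa using hi), ?_, ?_⟩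
  · intro i hi j hj e
    exact List.inj_on_of_nodup_map y1 (by simpa using hi) (by simpa using hj) e
  intro p hp q hq
  have sym : ∀ x y, A (min x y) (max x y) = true → A x y = true := by
    intro x y h
    rcases le_total x y with h' | h'
    · simpa [h'] using h
    · rw [hA']; simpa [h'] using h
  simp only [chk, List.all_eq_true] at k0 k1 k2
  have q0 := okp_cases (k0 p hp q hq)
  have q1 := okp_cases (k1 p hp q hq)
  have q2 := okp_cases (k2 p hp q hq)
  by_cases hq' : (min q.1 q.2, max q.1 q.2) ∈ fx
  · have := hfx _ (y3 _ hq')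
    apply sym
    rcases le_total q.1 q.2 with h' | h'
    · simpa [h'] using this
    · simp only [h', min_eq_right, max_eq_left] at this
      rw [min_comm, max_comm]; exact this
  · have q0 := q0.resolve_left hq'
    have q1 := q1.resolve_left hq'
    have q2 := q2.resolve_left hq'
    obtain ⟨u1, u2, u3, u4⟩ := q0
    have v4 := q1.2.2.2
    have w4 := q2.2.2.2
    set x := min q.1 q.2 with hx
    set y := max q.1 q.2 with hy
    have hw0 : 0 < w := by omega
    have key : A (piF w al s0 s1 s2 x) (piF w al s0 s1 s2 y) = true := by
      have ex : piF w al s0 s1 s2 x = al.getD x 0 := by simp only [piF, if_pos u1]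
      have hr : (y - 5) % w < w := Nat.mod_lt _ hw0
      have hdm := Nat.div_add_mod (y - 5) w
      have hg : (y - 5) / w < 3 := by
        rw [Nat.div_lt_iff_lt_mul hw0]; omega
      generalize hgg : (y - 5) / w = g at *
      generalize hrr : (y - 5) % w = r at *
      interval_cases g
      · have := B0 x u1 r hr (u4 rfl)
        have ey : piF w al s0 s1 s2 y = 5 + s0.getD r 0 := by
          have h5 : y - 5 = r := by omega
          simp only [piF]
          rw [if_neg (by omega), if_pos (by omega), h5]
        rw [ex, ey]; exact this
      · have := B1 x u1 r hr (v4 rfl)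
        rw [hid i1 hi1 x u1] at this
        have ey : piF w al s0 s1 s2 y = 5 + w + s1.getD r 0 := by
          have h5 : y - 5 - w = r := by omega
          simp only [piF]
          rw [if_neg (by omega), if_neg (by omega), if_pos (by omega), h5]
        rw [ex, ey]; exact this
      · have := B2 x u1 r hr (w4 rfl)
        rw [hid i2 hi2 x u1] at this
        have ey : piF w al s0 s1 s2 y = 5 + 2 * w + s2.getD r 0 := by
          have h5 : y - 5 - 2 * w = r := by omega
          simp only [piF]
          rw [if_neg (by omega), if_neg (by omega), if_neg (by omega), h5]
        rw [ex, ey]; exact this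
    rcases le_total q.1 q.2 with h' | h'
    · simpa [hx, hy, h'] using key
    · rw [hA']; simpa [hx, hy, h'] using key


section graph
variable {V : Type} [Fintype V] [DecidableEq V] (R : SimpleGraph V) [DecidableRel R.Adj]

def PV (p : List V) : Prop := lenok p.length = true ∧ ∀ q ∈ ppairs p, R.Adj q.1 q.2
def Wt {α : Type} (N : List (List α)) : ℕ := (N.map fun p => wl p.length).sum
def Hq {α : Type} (N : List (List α)) : ℕ := (N.map fun p => hl p.length).sum
def St (N : List (List V)) : Prop := (∀ p ∈ N, PV R p) ∧ N.flatten.Nodup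
def dg (x : V) (p : List V) : ℕ := (p.map fun y => (decide (R.Adj y x)).toNat).sum
def dE (e p : List V) : ℕ := (e.map fun x => dg R x p).sum

theorem ppairs_map {α β : Type} (g : α → β) (p : List α) :
    ppairs (p.map g) = (ppairs p).map (Prod.map g g) := by
  match p with
  | [] => rfl
  | [_] => rfl
  | [_, _] => rfl
  | [_, _, _] => rfl
  | [_, _, _, _] => rfl
  | [_, _, _, _, _] => rfl
  | _ :: _ :: _ :: _ :: _ :: _ :: _ => rfl

def patck (w : ℕ) (W0 : ℕ) (H0 : ℕ) (pats : List (List (List ℕ))) : Prop :=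
  ∀ P ∈ pats, P.flatten.Nodup ∧ (∀ i ∈ P.flatten, i < 5 + 3 * w) ∧ (∀ p ∈ P, lenok p.length = true) ∧
    (W0 < Wt P ∨ (Wt P = W0 ∧ H0 ≤ Hq P))

instance (w W0 H0 : ℕ) (pats : List (List (List ℕ))) : Decidable (patck w W0 H0 pats) := by
  unfold patck; infer_instance

theorem pkB : patck 1 7 100 patB := by decide +kernel
theorem pk1 : patck 2 13 1 pat1 := by decide +kernel
theorem pk2 : patck 2 13 100 pat2 := by decide +kernel
theorem pk4 : patck 2 13 100 pat4 := by decide +kernel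
theorem pk5 : patck 2 13 100 pat5 := by decide +kernel

theorem Wt_map {α β : Type} (g : α → β) (P : List (List α)) : Wt (P.map (List.map g)) = Wt P := by
  simp [Wt, Function.comp_def]
theorem Hq_map {α β : Type} (g : α → β) (P : List (List α)) : Hq (P.map (List.map g)) = Hq P := by
  simp [Hq, Function.comp_def]

/-- conclusion of the finite lemmas -/
def Found (l : List V) (W0 H0 : ℕ) : Prop :=
  ∃ N : List (List V), St R N ∧ (∀ x ∈ N.flatten, x ∈ l) ∧
    (W0 < Wt N ∨ (Wt N = W0 ∧ H0 ≤ Hq N))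

def adjB (l : List V) (c : V) (i j : ℕ) : Bool := decide (R.Adj (l.getD i c) (l.getD j c))

theorem adjB_symm (l : List V) (c : V) (i j : ℕ) : adjB R l c i j = adjB R l c j i := by
  unfold adjB; simp only [SimpleGraph.adj_comm]

theorem genG {w W0 H0 : ℕ} {pats : List (List (List ℕ))} (hpk : patck w W0 H0 pats)
    (l : List V) (hl : l.length = 5 + 3 * w) (hnd : l.Nodup) (c : V)
    (h : ∃ P ∈ pats, ∃ f : ℕ → ℕ, (∀ i < 5 + 3 * w, f i < 5 + 3 * w) ∧
      (∀ i < 5 + 3 * w, ∀ j < 5 + 3 * w, f i = f j → i = j) ∧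
      ∀ p ∈ P, ∀ q ∈ ppairs p,
        adjB R l c (f q.1) (f q.2) = true) :
    Found R l W0 H0 := by
  obtain ⟨P, hP, f, hf1, hf2, hA⟩ := h
  obtain ⟨k1, k2, k3, k4⟩ := hpk P hP
  refine ⟨P.map (List.map fun i => l.getD (f i) c), ⟨?_, ?_⟩, ?_, ?_⟩
  · intro p hp
    rw [List.mem_map] at hp
    obtain ⟨p', hp', rfl⟩ := hp
    refine ⟨by simpa using k3 p' hp', fun q hq => ?_⟩
    rw [ppairs_map, List.mem_map] at hq
    obtain ⟨q', hq', rfl⟩ := hq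
    have := hA p' hp' q' hq'
    simpa [adjB] using this
  · rw [← List.map_flatten]
    refine List.Nodup.map_on ?_ k1
    intro x hx y hy hxy
    have hx' := hf1 x (k2 x hx)
    have hy' := hf1 y (k2 y hy)
    rw [List.getD_eq_getElem _ _ (by omega), List.getD_eq_getElem _ _ (by omega)] at hxy
    exact hf2 x (k2 x hx) y (k2 y hy) ((List.Nodup.getElem_inj_iff hnd).1 hxy)
  · intro x hx
    rw [← List.map_flatten, List.mem_map] at hx
    obtain ⟨i, hi, rfl⟩ := hx
    have hx' := hf1 i (k2 i hi)
    rw [List.getD_eq_getElem _ _ (by omega)]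
    exact List.getElem_mem _
  · rw [Wt_map, Hq_map]; exact k4

theorem auts_perm : ∀ al ∈ auts8, al.Perm (List.range 5) := by decide +kernel
theorem id5_perm : ∀ al ∈ id5, al.Perm (List.range 5) := by decide +kernel
theorem sw2_lt : ∀ s ∈ sw2, ∀ j < 2, s.getD j 0 < 2 := by decide +kernel
theorem id2_lt : ∀ s ∈ id2, ∀ j < 2, s.getD j 0 < 2 := by decide +kernel
theorem id1_lt : ∀ s ∈ id1, ∀ j < 1, s.getD j 0 < 1 := by decide +kernel

def IsBow (p : List V) : Prop := p.length = 5 ∧ PV R p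
def IsEdge (p : List V) : Prop := p.length = 2 ∧ PV R p
def IsQuad (p : List V) : Prop := p.length = 4 ∧ PV R p

theorem len5 {p : List V} (h : p.length = 5) : ∃ c a b d e, p = [c, a, b, d, e] := by
  match p, h with
  | [c, a, b, d, e], _ => exact ⟨c, a, b, d, e, rfl⟩
theorem len2 {p : List V} (h : p.length = 2) : ∃ x y, p = [x, y] := by
  match p, h with
  | [c, a], _ => exact ⟨c, a, rfl⟩
theorem len4 {p : List V} (h : p.length = 4) : ∃ a b c d, p = [a, b, c, d] := by
  match p, h with
  | [a, b, c, d], _ => exact ⟨a, b, c, d, rfl⟩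

theorem bow_adj {c a b d e : V} (h : IsBow R [c, a, b, d, e]) : R.Adj c a ∧ R.Adj c b ∧
    R.Adj c d ∧ R.Adj c e ∧ R.Adj a b ∧ R.Adj d e := by
  simpa [ppairs] using h.2.2
theorem edge_adj {x y : V} (h : IsEdge R [x, y]) : R.Adj x y := by
  simpa [ppairs] using h.2.2
theorem quad_adj {a b c d : V} (h : IsQuad R [a, b, c, d]) : R.Adj a b ∧ R.Adj c d ∧
    R.Adj a c ∧ R.Adj a d ∧ R.Adj b c := by
  simpa [ppairs] using h.2.2

theorem FLB {p : List V} (hp : IsBow R p) (x y z : V) (hnd : (p ++ [x, y, z]).Nodup)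
    (h0 : 4 ≤ dg R x p) (h1 : 3 ≤ dg R y p) (h2 : 3 ≤ dg R z p) :
    Found R (p ++ [x, y, z]) 7 100 := by
  obtain ⟨c, a, b, d, e, rfl⟩ := len5 hp.1
  obtain ⟨A1, A2, A3, A4, A5, A6⟩ := bow_adj R hp
  refine genG R pkB _ rfl hnd c ?_
  refine gen (Or.inl rfl) pBx0 pBx1 pBx2 cBx0 cBx1 cBx2 tB symB id5_perm id1_lt id1_lt id1_lt
    (adjB R _ c) (adjB_symm R _ c) ?_ ?_ ?_ ?_
  · simp [adjB, fxB, A1, A2, A3, A4, A5, A6]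
  · exact h0
  · exact h1
  · exact h2

theorem FLg {pats : List (List (List ℕ))} {W0 H0 n0 n1 n2 : ℕ} (fx : List (ℕ × ℕ))
    (hpk : patck 2 W0 H0 pats)
    {auts S0 S1 S2 : List (List ℕ)} {nd0 nd1 nd2 C0 C1 C2 : List ℕ}
    (p0 : pchk (fxE ++ fx) 2 0 nd0 pats = true) (p1 : pchk (fxE ++ fx) 2 1 nd1 pats = true)
    (p2 : pchk (fxE ++ fx) 2 2 nd2 pats = true)
    (c0 : cov 2 n0 auts S0 nd0 C0 = true) (c1 : cov 2 n1 id5 S1 nd1 C1 = true)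
    (c2 : cov 2 n2 id5 S2 nd2 C2 = true) (ht : tri C0 C1 C2 = true)
    (hsy : symc (fxE ++ fx) 2 auts S0 S1 S2)
    (hA : ∀ al ∈ auts, al.Perm (List.range 5))
    (hS0 : ∀ s ∈ S0, ∀ j < 2, s.getD j 0 < 2)
    (hS1 : ∀ s ∈ S1, ∀ j < 2, s.getD j 0 < 2)
    (hS2 : ∀ s ∈ S2, ∀ j < 2, s.getD j 0 < 2)
    {p e0 e1 e2 : List V} (hp : IsBow R p) (he0 : IsEdge R e0) (he1 : IsEdge R e1)
    (he2 : IsEdge R e2) (hnd : (p ++ e0 ++ e1 ++ e2).Nodup)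
    (h0 : n0 ≤ dE R e0 p) (h1 : n1 ≤ dE R e1 p) (h2 : n2 ≤ dE R e2 p)
    (hfx : ∀ c, ∀ q ∈ fx, R.Adj ((p ++ e0 ++ e1 ++ e2).getD q.1 c) ((p ++ e0 ++ e1 ++ e2).getD q.2 c)) :
    Found R (p ++ e0 ++ e1 ++ e2) W0 H0 := by
  obtain ⟨c, a, b, d, e, rfl⟩ := len5 hp.1
  obtain ⟨A1, A2, A3, A4, A5, A6⟩ := bow_adj R hp
  obtain ⟨u0, v0, rfl⟩ := len2 he0.1
  obtain ⟨u1, v1, rfl⟩ := len2 he1.1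
  obtain ⟨u2, v2, rfl⟩ := len2 he2.1
  refine genG R hpk _ rfl hnd c ?_
  refine gen (Or.inr rfl) p0 p1 p2 c0 c1 c2 ht hsy hA hS0 hS1 hS2
    (adjB R _ c) (adjB_symm R _ c) ?_ ?_ ?_ ?_
  · intro q hq
    rw [List.mem_append] at hq
    rcases hq with hq | hq
    · revert q
      simp [adjB, fxE, fxB, A1, A2, A3, A4, A5, A6, edge_adj R he0, edge_adj R he1, edge_adj R he2]
    · simpa [adjB] using hfx c q hq
  · exact h0
  · exact h1
  · exact h2

theorem FL1 {p e0 e1 e2 : List V} (hp : IsBow R p) (he0 : IsEdge R e0) (he1 : IsEdge R e1)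
    (he2 : IsEdge R e2) (hnd : (p ++ e0 ++ e1 ++ e2).Nodup)
    (h0 : 7 ≤ dE R e0 p) (h1 : 6 ≤ dE R e1 p) (h2 : 6 ≤ dE R e2 p) :
    Found R (p ++ e0 ++ e1 ++ e2) 13 1 :=
  FLg R [] pk1 p1x0 p1x1 p1x2 c1x0 c1x1 c1x2 t1 sym1 auts_perm sw2_lt sw2_lt sw2_lt
    hp he0 he1 he2 hnd h0 h1 h2 (by simp)

theorem FL2 {p e0 e1 e2 : List V} (hp : IsBow R p) (he0 : IsEdge R e0) (he1 : IsEdge R e1)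
    (he2 : IsEdge R e2) (hnd : (p ++ e0 ++ e1 ++ e2).Nodup)
    (h0 : 7 ≤ dE R e0 p) (h1 : 7 ≤ dE R e1 p) (h2 : 7 ≤ dE R e2 p) :
    Found R (p ++ e0 ++ e1 ++ e2) 13 100 :=
  FLg R [] pk2 p2x0 p2x1 p2x2 c2x0 c2x1 c2x2 t2 sym1 auts_perm sw2_lt sw2_lt sw2_lt
    hp he0 he1 he2 hnd h0 h1 h2 (by simp)

theorem split_quad {a b c d : V} (h : IsQuad R [a, b, c, d]) : IsEdge R [a, b] ∧ IsEdge R [c, d] := by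
  have := quad_adj R h
  simp [IsEdge, PV, lenok, ppairs, this]

theorem FL4 {p e2 : List V} {a b c d : V} (hp : IsBow R p) (hq : IsQuad R [a, b, c, d])
    (he2 : IsEdge R e2) (hnd : (p ++ [a, b] ++ [c, d] ++ e2).Nodup)
    (h0 : 7 ≤ dE R [a, b] p) (h1 : 6 ≤ dE R [c, d] p) (h2 : 6 ≤ dE R e2 p) :
    Found R (p ++ [a, b] ++ [c, d] ++ e2) 13 100 := by
  refine FLg R [(5, 7), (5, 8), (6, 7)] pk4 p4x0 p4x1 p4x2 c4x0 c4x1 c4x2 t4 sym4 auts_perm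
    id2_lt id2_lt sw2_lt hp (split_quad R hq).1 (split_quad R hq).2 he2 hnd h0 h1 h2 ?_
  obtain ⟨x1, x2, x3, x4, x5, rfl⟩ := len5 hp.1
  have := quad_adj R hq
  simp [this]

theorem FL5 {p e0 : List V} {a b c d : V} (hp : IsBow R p) (he0 : IsEdge R e0)
    (hq : IsQuad R [a, b, c, d]) (hnd : (p ++ e0 ++ [a, b] ++ [c, d]).Nodup)
    (h0 : 8 ≤ dE R e0 p) (h1 : 6 ≤ dE R [a, b] p) (h2 : 6 ≤ dE R [c, d] p) :
    Found R (p ++ e0 ++ [a, b] ++ [c, d]) 13 100 := by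
  refine FLg R [(7, 9), (7, 10), (8, 9)] pk5 p5x0 p5x1 p5x2 c5x0 c5x1 c5x2 t5 sym5 auts_perm
    sw2_lt id2_lt id2_lt hp he0 (split_quad R hq).1 (split_quad R hq).2 hnd h0 h1 h2 ?_
  obtain ⟨x1, x2, x3, x4, x5, rfl⟩ := len5 hp.1
  obtain ⟨u0, v0, rfl⟩ := len2 he0.1
  have := quad_adj R hq
  simp [this]

end graph


section main
variable {V : Type} [Fintype V] [DecidableEq V] (R : SimpleGraph V) [DecidableRel R.Adj]

theorem Wt_append {α : Type} (N N' : List (List α)) : Wt (N ++ N') = Wt N + Wt N' := by simp [Wt]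
theorem Hq_append {α : Type} (N N' : List (List α)) : Hq (N ++ N') = Hq N + Hq N' := by simp [Hq]
theorem Wt_perm {α : Type} {N N' : List (List α)} (h : N.Perm N') : Wt N = Wt N' :=
  (h.map _).sum_eq
theorem Hq_perm {α : Type} {N N' : List (List α)} (h : N.Perm N') : Hq N = Hq N' :=
  (h.map _).sum_eq
theorem Hq_le_Wt {α : Type} (N : List (List α)) : Hq N ≤ Wt N := by
  induction N with
  | nil => simp [Hq, Wt]
  | cons p N ih =>
    have h : hl p.length ≤ wl p.length := by unfold hl wl; split_ifs <;> omega
    simp only [Hq, Wt, List.map_cons, List.sum_cons] at *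
    omega
theorem Wt_le {α : Type} (N : List (List α)) : Wt N ≤ 2 * N.flatten.length := by
  induction N with
  | nil => simp [Wt]
  | cons p N ih =>
    have h : wl p.length ≤ 2 * p.length := by unfold wl; split_ifs <;> omega
    simp only [Wt, List.map_cons, List.sum_cons, List.flatten_cons, List.length_append] at *
    omega

theorem St_perm {N N' : List (List V)} (h : N.Perm N') (hN : St R N) : St R N' :=
  ⟨fun p hp => hN.1 p (h.mem_iff.2 hp), (h.flatten.nodup_iff).1 hN.2⟩

theorem St_append {N N' : List (List V)} : St R (N ++ N') ↔
    St R N ∧ St R N' ∧ ∀ x ∈ N.flatten, x ∉ N'.flatten := by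
  unfold St
  rw [List.flatten_append, List.nodup_append']
  simp only [List.mem_append, List.Disjoint]
  constructor
  · rintro ⟨h1, h2, h3, h4⟩
    exact ⟨⟨fun p hp => h1 p (Or.inl hp), h2⟩, ⟨fun p hp => h1 p (Or.inr hp), h3⟩,
      fun x hx hx' => h4 hx hx'⟩
  · rintro ⟨⟨h1, h2⟩, ⟨h3, h4⟩, h5⟩
    exact ⟨fun p hp => hp.elim (h1 p) (h3 p), h2, h4, fun x hx hx' => h5 x hx hx'⟩

def Mx (N : List (List V)) : Prop :=
  St R N ∧ ∀ N', St R N' → Wt N' ≤ Wt N ∧ (Wt N' = Wt N → Hq N' ≤ Hq N)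

theorem St_bound {N : List (List V)} (h : St R N) : Wt N ≤ 2 * Fintype.card V :=
  (Wt_le N).trans (by have := h.2.length_le_card; omega)

theorem exists_Mx : ∃ N : List (List V), Mx R N := by
  have h0 : St R ([] : List (List V)) := by simp [St]
  by_contra hno
  have key : ∀ n : ℕ, ∃ N, St R N ∧ n ≤ (2 * Fintype.card V + 1) * Wt N + Hq N := by
    intro n
    induction n with
    | zero => exact ⟨[], h0, by simp⟩
    | succ n ih =>
      obtain ⟨N, hN, hn⟩ := ih
      by_contra hc
      apply hno
      refine ⟨N, hN, fun N' hN' => ?_⟩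
      have hlt : ¬ (n + 1 ≤ (2 * Fintype.card V + 1) * Wt N' + Hq N') := fun h => hc ⟨N', hN', h⟩
      have b1 := St_bound R hN
      have b2 := Hq_le_Wt N
      have hle : Wt N' ≤ Wt N := by
        by_contra h
        have : (2 * Fintype.card V + 1) * (Wt N + 1) ≤ (2 * Fintype.card V + 1) * Wt N' :=
          Nat.mul_le_mul_left _ (by omega)
        rw [Nat.mul_add] at this
        omega
      refine ⟨hle, fun e => ?_⟩
      rw [e] at hlt
      omega
  obtain ⟨N, hN, hn⟩ := key ((2 * Fintype.card V + 1) * (2 * Fintype.card V) + 2 * Fintype.card V + 1)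
  have b1 := St_bound R hN
  have b2 := Hq_le_Wt N
  have : (2 * Fintype.card V + 1) * Wt N ≤ (2 * Fintype.card V + 1) * (2 * Fintype.card V) :=
    Nat.mul_le_mul_left _ b1
  omega

theorem repl_St {N old rest new : List (List V)} (hN : St R N) (hp : N.Perm (old ++ rest))
    (hnew : St R new) (hx : ∀ x ∈ new.flatten, x ∈ old.flatten ∨ x ∉ N.flatten) :
    St R (new ++ rest) := by
  have h1 := (St_append R).1 (St_perm R hp hN)
  rw [St_append]
  refine ⟨hnew, h1.2.1, fun x h h' => ?_⟩
  rcases hx x h with h2 | h2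
  · exact h1.2.2 x h2 h'
  · apply h2
    rw [hp.flatten.mem_iff, List.flatten_append, List.mem_append]
    exact Or.inr h'

theorem Mx_repl {N old rest new : List (List V)} (hN : Mx R N) (hp : N.Perm (old ++ rest))
    (hnew : St R new) (hx : ∀ x ∈ new.flatten, x ∈ old.flatten ∨ x ∉ N.flatten) :
    Wt new ≤ Wt old ∧ (Wt new = Wt old → Hq new ≤ Hq old) := by
  have h := hN.2 _ (repl_St R hN.1 hp hnew hx)
  rw [Wt_perm hp, Hq_perm hp, Wt_append, Wt_append, Hq_append, Hq_append] at h
  constructor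
  · omega
  · intro e
    have := h.2 (by omega)
    omega

def WMx (N : List (List V)) : Prop := St R N ∧ ∀ N', St R N' → Wt N' ≤ Wt N

theorem WMx_repl {N old rest new : List (List V)} (hN : WMx R N) (hp : N.Perm (old ++ rest))
    (hnew : St R new) (hx : ∀ x ∈ new.flatten, x ∈ old.flatten ∨ x ∉ N.flatten) :
    Wt new ≤ Wt old := by
  have h := hN.2 _ (repl_St R hN.1 hp hnew hx)
  rw [Wt_perm hp, Wt_append, Wt_append] at h
  omega

theorem pick {α : Type} (f : α → ℕ) (c : ℕ) (l : List α) (h : c * l.length < (l.map f).sum) :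
    ∃ e r, l.Perm (e :: r) ∧ c < f e ∧ l.length = r.length + 1 ∧
      (l.map f).sum = f e + (r.map f).sum := by
  have : ∃ e ∈ l, c < f e := by
    by_contra hc
    push Not at hc
    have : (l.map f).sum ≤ (l.map f).length • c := List.sum_le_card_nsmul _ _ (by
      intro x hx
      rw [List.mem_map] at hx
      obtain ⟨y, hy, rfl⟩ := hx
      exact hc y hy)
    rw [List.length_map, smul_eq_mul, mul_comm] at this
    omega
  obtain ⟨e, he, hc⟩ := this
  obtain ⟨s, t, rfl⟩ := List.append_of_mem he
  exact ⟨e, s ++ t, List.perm_middle, hc, by simp; omega, by simp; omega⟩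

theorem dg_append (x : V) (p q : List V) : dg R x (p ++ q) = dg R x p + dg R x q := by simp [dg]
theorem dg_perm (x : V) {p q : List V} (h : p.Perm q) : dg R x p = dg R x q := (h.map _).sum_eq
theorem dg_flatten (x : V) (L : List (List V)) : dg R x L.flatten = (L.map (dg R x)).sum := by
  induction L with
  | nil => simp [dg]
  | cons p L ih => simp [dg_append, ih]
theorem dg_le (x : V) (p : List V) : dg R x p ≤ p.length := by
  induction p with
  | nil => simp [dg]
  | cons a p ih =>
    have : (decide (R.Adj a x)).toNat ≤ 1 := Bool.toNat_le _
    simp only [dg, List.map_cons, List.sum_cons, List.length_cons] at *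
    omega
theorem dE_append (e f p : List V) : dE R (e ++ f) p = dE R e p + dE R f p := by simp [dE]
theorem dE_le (e p : List V) : dE R e p ≤ e.length * p.length := by
  induction e with
  | nil => simp [dE]
  | cons a e ih =>
    have := dg_le R a p
    simp only [dE, List.map_cons, List.sum_cons, List.length_cons] at *
    rw [Nat.add_mul]; omega
theorem dE_two (u v : V) (p : List V) : dE R [u, v] p = dg R u p + dg R v p := by simp [dE]
theorem dg_finset (x : V) (p : List V) (h : p.Nodup) :
    dg R x p = (p.toFinset.filter fun y => R.Adj y x).card := by
  induction p with
  | nil => simp [dg]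
  | cons a p ih =>
    rw [List.nodup_cons] at h
    have ih := ih h.2
    have e : dg R x (a :: p) = (decide (R.Adj a x)).toNat + dg R x p := by simp [dg]
    rw [e, ih, List.toFinset_cons, Finset.filter_insert]
    by_cases hA : R.Adj a x
    · rw [if_pos hA, Finset.card_insert_of_notMem]
      · simp [hA]; omega
      · simp [h.1]
    · rw [if_neg hA]; simp [hA]

theorem deg_eq (x : V) (l : List V) (h : l.Nodup) (hall : ∀ y, y ∈ l) :
    R.degree x = dg R x l := by
  rw [dg_finset R x l h, ← SimpleGraph.card_neighborFinset_eq_degree]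
  congr 1
  ext y
  simp [hall, SimpleGraph.adj_comm]

theorem sum_swap {α β : Type} (f : α → β → ℕ) (l : List α) (m : List β) :
    (l.map fun a => (m.map fun b => f a b).sum).sum =
      (m.map fun b => (l.map fun a => f a b).sum).sum := by
  induction l with
  | nil => simp
  | cons a l ih => simp [ih, List.sum_map_add]

theorem sum_lb {α : Type} (f : α → ℕ) (c : ℕ) (l : List α) (h : ∀ a ∈ l, c ≤ f a) :
    l.length * c ≤ (l.map f).sum := by
  induction l with
  | nil => simp
  | cons a l ih =>
    have h1 := h a (by simp)
    have h2 := ih fun b hb => h b (by simp [hb])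
    simp only [List.map_cons, List.sum_cons, List.length_cons]
    rw [Nat.add_mul]; omega

theorem to_emb (B : List (List V)) : (∀ p ∈ B, IsBow R p) → B.flatten.Nodup →
    ∃ T : Finset (Fin 5 ↪ V),
      (∀ e ∈ T, ∀ a b : Fin 5, Bowtie.Adj a b → R.Adj (e a) (e b)) ∧
      (∀ e ∈ T, ∀ f ∈ T, e ≠ f → ∀ a b : Fin 5, e a ≠ f b) ∧
      (∀ e ∈ T, ∀ a, e a ∈ B.flatten) ∧ T.card = B.length := by
  induction B with
  | nil => intro _ _; exact ⟨∅, by simp⟩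
  | cons p B ih =>
    intro h hnd
    rw [List.flatten_cons, List.nodup_append'] at hnd
    obtain ⟨T, h1, h2, h3, h4⟩ := ih (fun q hq => h q (by simp [hq])) hnd.2.1
    have hp := h p (by simp)
    obtain ⟨c, a, b, d, e, rfl⟩ := len5 hp.1
    obtain ⟨A1, A2, A3, A4, A5, A6⟩ := bow_adj R hp
    let f : Fin 5 ↪ V := ⟨fun i => [c, a, b, d, e].get i, List.nodup_iff_injective_get.1 hnd.1⟩
    have hf : ∀ i, f i ∈ [c, a, b, d, e] := fun i => List.get_mem [c, a, b, d, e] i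
    have hdis : ∀ g ∈ T, ∀ i j, f i ≠ g j := by
      intro g hg i j he
      exact hnd.2.2 (hf i) (he ▸ h3 g hg j)
    have hfT : f ∉ T := fun hh => hdis f hh 0 0 rfl
    refine ⟨insert f T, ?_, ?_, ?_, ?_⟩
    · intro g hg
      rw [Finset.mem_insert] at hg
      rcases hg with rfl | hg
      · intro i j hij
        have A1' := A1.symm
        have A2' := A2.symm
        have A3' := A3.symm
        have A4' := A4.symm
        have A5' := A5.symm
        have A6' := A6.symm
        revert hij
        fin_cases i <;> fin_cases j <;>
          simp [Bowtie, f, A1, A2, A3, A4, A5, A6, A1', A2', A3', A4', A5', A6']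
      · exact h1 g hg
    · intro g hg g' hg' hne
      rw [Finset.mem_insert] at hg hg'
      rcases hg with rfl | hg <;> rcases hg' with rfl | hg'
      · exact absurd rfl hne
      · exact hdis g' hg'
      · intro i j he; exact hdis g hg j i he.symm
      · exact h2 g hg g' hg' hne
    · intro g hg i
      rw [Finset.mem_insert] at hg
      rw [List.flatten_cons, List.mem_append]
      rcases hg with rfl | hg
      · exact Or.inl (hf i)
      · exact Or.inr (h3 g hg i)
    · rw [Finset.card_insert_of_notMem hfT, h4]; rfl

end main


section level
variable {V : Type} [Fintype V] [DecidableEq V] (R : SimpleGraph V) [DecidableRel R.Adj]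

/-- a decomposition: bowties, edges, uncovered vertices -/
structure Dec (B M : List (List V)) (I : List V) : Prop where
  hB : ∀ p ∈ B, IsBow R p
  hM : ∀ p ∈ M, IsEdge R p
  mx : WMx R (B ++ M)
  nd : (B.flatten ++ M.flatten ++ I).Nodup
  all : ∀ x, x ∈ B.flatten ++ M.flatten ++ I

variable {R} {B M : List (List V)} {I : List V}

theorem Dec.notMem (D : Dec R B M I) {x : V} (hx : x ∈ I) : x ∉ (B ++ M).flatten := by
  intro h
  have := D.nd
  rw [List.nodup_append'] at this
  rw [List.flatten_append] at h
  exact this.2.2 h hx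

theorem St_bow {u a b c d : V} (h : [u, a, b, c, d].Nodup) (h1 : R.Adj u a) (h2 : R.Adj u b)
    (h3 : R.Adj u c) (h4 : R.Adj u d) (h5 : R.Adj a b) (h6 : R.Adj c d) :
    St R [[u, a, b, c, d]] := by
  refine ⟨?_, by simpa using h⟩
  intro p hp
  obtain rfl := List.mem_singleton.1 hp
  refine ⟨rfl, fun q hq => ?_⟩
  simp only [ppairs, List.mem_cons, List.not_mem_nil, or_false] at hq
  rcases hq with rfl | rfl | rfl | rfl | rfl | rfl <;> assumption

theorem dg_full {x a b : V} (h : 2 ≤ dg R x [a, b]) : R.Adj x a ∧ R.Adj x b := by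
  simp only [dg, List.map_cons, List.map_nil, List.sum_cons, List.sum_nil] at h
  by_cases h1 : R.Adj a x <;> by_cases h2 : R.Adj b x <;> simp [h1, h2] at h
  exact ⟨h1.symm, h2.symm⟩

theorem Dec.deg (D : Dec R B M I) (x : V) : R.minDegree ≤
    (B.map (dg R x)).sum + (M.map (dg R x)).sum + dg R x I := by
  have := R.minDegree_le_degree x
  rw [deg_eq R x _ D.nd D.all, dg_append, dg_append, dg_flatten, dg_flatten] at this
  exact this

theorem Dec.indep (D : Dec R B M I) {x : V} (hx : x ∈ I) : dg R x I = 0 := by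
  have hI : I.Nodup := (List.nodup_append'.1 D.nd).2.1
  rw [dg_finset R x I hI, Finset.card_eq_zero, Finset.filter_eq_empty_iff]
  intro y hy hA
  rw [List.mem_toFinset] at hy
  have := WMx_repl R D.mx (old := []) (rest := B ++ M) (new := [[y, x]]) (List.Perm.refl _)
    ⟨by simp [PV, lenok, ppairs, hA], by simp [hA.ne]⟩ (by
      intro z hz
      right
      simp at hz
      rcases hz with rfl | rfl
      · exact D.notMem hy
      · exact D.notMem hx)
  simp [Wt, wl] at this

theorem Dec.x_bound (D : Dec R B M I) {x : V} (hx : x ∈ I) :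
    R.minDegree ≤ (B.map (dg R x)).sum + M.length + 1 := by
  have h := D.deg x
  rw [D.indep hx] at h
  by_contra hc
  obtain ⟨e1, r1, k1, k2, k3, k4⟩ := pick (dg R x) 1 M (by omega)
  have l1 := (D.hM e1 (k1.mem_iff.2 (by simp)))
  have b1 := dg_le R x e1
  rw [l1.1] at b1
  obtain ⟨e2, r2, m1, m2, m3, m4⟩ := pick (dg R x) 1 r1 (by omega)
  have l2 := (D.hM e2 (k1.mem_iff.2 (by simp [m1.mem_iff])))
  obtain ⟨a, b, rfl⟩ := len2 l1.1
  obtain ⟨c, d, rfl⟩ := len2 l2.1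
  have hp : (B ++ M).Perm ([[a, b], [c, d]] ++ (r2 ++ B)) := by
    refine (List.perm_append_comm.trans ((k1.trans (m1.cons _)).append_right B)).trans ?_
    simp
  have hst := St_perm R hp D.mx.1
  have hnd := ((St_append R).1 hst).1.2
  have hxn : x ∉ [[a, b], [c, d]].flatten := by
    intro h'
    exact D.notMem hx (by rw [hp.flatten.mem_iff, List.flatten_append, List.mem_append]; exact Or.inl h')
  have A1 := dg_full k2
  have A2 := dg_full m2
  have := WMx_repl R D.mx hp (new := [[x, a, b, c, d]])
    (St_bow (by
      rw [List.nodup_cons]; exact ⟨by simpa using hxn, by simpa using hnd⟩)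
      A1.1 A1.2 A2.1 A2.2 (edge_adj R l1) (edge_adj R l2)) (by
      intro z hz
      simp only [List.flatten_cons, List.flatten_nil, List.append_nil, List.mem_cons, List.not_mem_nil, or_false] at hz
      rcases hz with rfl | hz
      · exact Or.inr (D.notMem hx)
      · left; simpa using hz)
  simp [Wt, wl] at this

theorem Dec.aug (D : Dec R B M I) {u v : V} {M' : List (List V)} (hM : M.Perm ([u, v] :: M'))
    {x y : V} (hx : x ∈ I) (hy : y ∈ I) (hne : x ≠ y) (h1 : R.Adj x u) (h2 : R.Adj y v) : False := by
  have hp : (B ++ M).Perm ([[u, v]] ++ (M' ++ B)) := by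
    refine (List.perm_append_comm.trans (hM.append_right B)).trans ?_
    simp
  have hst := St_perm R hp D.mx.1
  have hnd := ((St_append R).1 hst).1.2
  have hn : ∀ z ∈ I, z ∉ [[u, v]].flatten := by
    intro z hz h'
    exact D.notMem hz (by rw [hp.flatten.mem_iff, List.flatten_append, List.mem_append]; exact Or.inl h')
  have hx' := hn x hx
  have hy' := hn y hy
  simp at hx' hy' hnd
  have := WMx_repl R D.mx hp (new := [[x, u], [v, y]]) (by
      refine ⟨by simp [PV, lenok, ppairs, h1, h2.symm], ?_⟩
      have a1 : u ≠ y := fun h => hy'.1 h.symm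
      have a2 : v ≠ y := fun h => hy'.2 h.symm
      simp [hx', hne, hnd, a1, a2]) (by
      intro z hz
      simp at hz
      rcases hz with rfl | rfl | rfl | rfl
      · exact Or.inr (D.notMem hx)
      · left; simp
      · left; simp
      · exact Or.inr (D.notMem hy))
  simp [Wt, wl] at this

theorem Dec.uI (D : Dec R B M I) {u v : V} {M' : List (List V)} (hM : M.Perm ([u, v] :: M')) :
    dg R u I + dg R v I ≤ I.length + 2 := by
  have hI : I.Nodup := (List.nodup_append'.1 D.nd).2.1
  have key : ∀ a b : V, (∀ x ∈ I, ∀ y ∈ I, x ≠ y → R.Adj x a → R.Adj y b → False) →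
      dg R a I = 0 ∨ dg R b I ≤ 1 := by
    intro a b h
    by_cases h0 : dg R a I = 0
    · exact Or.inl h0
    right
    rw [dg_finset R a I hI, Finset.card_eq_zero, ← ne_eq, ← Finset.nonempty_iff_ne_empty] at h0
    obtain ⟨x, hx⟩ := h0
    simp only [Finset.mem_filter, List.mem_toFinset] at hx
    rw [dg_finset R b I hI]
    refine (Finset.card_le_card (t := {x}) ?_).trans (by simp)
    intro y hy
    simp only [Finset.mem_filter, List.mem_toFinset] at hy
    by_contra hne
    exact h x hx.1 y hy.1 (fun h' => hne (by simp [h'])) hx.2 hy.2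
  have k1 := key u v fun x hx y hy hne h1 h2 => D.aug hM hx hy hne h1 h2
  have k2 := key v u fun x hx y hy hne h1 h2 => D.aug hM hy hx hne.symm h2 h1
  have b1 := dg_le R u I
  have b2 := dg_le R v I
  omega

theorem Dec.nobow (D : Dec R B M I) {u v a b c d : V}
    {rest : List (List V)} (hM : M.Perm ([u, v] :: [a, b] :: [c, d] :: rest))
    (h : (2 ≤ dg R u [a, b] ∧ 2 ≤ dg R u [c, d]) ∨ (2 ≤ dg R v [a, b] ∧ 2 ≤ dg R v [c, d])) :
    False := by
  have hp : (B ++ M).Perm ([[u, v], [a, b], [c, d]] ++ (rest ++ B)) := by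
    refine (List.perm_append_comm.trans (hM.append_right B)).trans ?_
    simp
  have hst := St_perm R hp D.mx.1
  have hnd := ((St_append R).1 hst).1.2
  have l1 := (D.hM [a, b] (hM.mem_iff.2 (by simp)))
  have l2 := (D.hM [c, d] (hM.mem_iff.2 (by simp)))
  have main : ∀ z, z = u ∨ z = v → 2 ≤ dg R z [a, b] → 2 ≤ dg R z [c, d] → False := by
    intro z hz k1 k2
    have A1 := dg_full k1
    have A2 := dg_full k2
    have hnd' : [z, a, b, c, d].Nodup := by
      simp at hnd
      rcases hz with rfl | rfl <;> simp <;> tauto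
    have := WMx_repl R D.mx hp (new := [[z, a, b, c, d]])
      (St_bow hnd' A1.1 A1.2 A2.1 A2.2 (edge_adj R l1) (edge_adj R l2)) (by
        intro y hy
        left
        simp at hy ⊢
        rcases hz with rfl | rfl <;> tauto)
    simp [Wt, wl] at this
  rcases h with h | h
  · exact main u (Or.inl rfl) h.1 h.2
  · exact main v (Or.inr rfl) h.1 h.2

theorem Dec.uM (D : Dec R B M I) {u v : V} {M' : List (List V)} (hM : M.Perm ([u, v] :: M')) :
    (M'.map (dE R [u, v])).sum ≤ 2 * M'.length + 4 := by
  by_contra hc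
  have hE : ∀ f ∈ M', IsEdge R f := fun f hf => D.hM f (hM.mem_iff.2 (by simp [hf]))
  have hcap : ∀ f ∈ M', dE R [u, v] f ≤ 4 := by
    intro f hf
    have := dE_le R [u, v] f
    rw [(hE f hf).1] at this
    simpa using this
  obtain ⟨e1, r1, k1, k2, k3, k4⟩ := pick (dE R [u, v]) 2 M' (by omega)
  have c1 := hcap e1 (k1.mem_iff.2 (by simp))
  obtain ⟨e2, r2, m1, m2, m3, m4⟩ := pick (dE R [u, v]) 2 r1 (by omega)
  have c2 := hcap e2 (k1.mem_iff.2 (by simp [m1.mem_iff]))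
  obtain ⟨e3, r3, n1, n2, n3, n4⟩ := pick (dE R [u, v]) 2 r2 (by omega)
  have l1 := hE e1 (k1.mem_iff.2 (by simp))
  have l2 := hE e2 (k1.mem_iff.2 (by simp [m1.mem_iff]))
  have l3 := hE e3 (k1.mem_iff.2 (by simp [m1.mem_iff, n1.mem_iff]))
  have P : M.Perm ([u, v] :: e1 :: e2 :: e3 :: r3) :=
    hM.trans ((k1.trans ((m1.trans (n1.cons _)).cons _)).cons _)
  obtain ⟨a1, b1, rfl⟩ := len2 l1.1
  obtain ⟨a2, b2, rfl⟩ := len2 l2.1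
  obtain ⟨a3, b3, rfl⟩ := len2 l3.1
  have two : ∀ x a b : V, dg R x [a, b] ≤ 2 := fun x a b => dg_le R x [a, b]
  rw [dE_two] at k2 m2 n2
  have q1 := two u a1 b1
  have q2 := two v a1 b1
  have q3 := two u a2 b2
  have q4 := two v a2 b2
  have q5 := two u a3 b3
  have q6 := two v a3 b3
  have P13 : M.Perm ([u, v] :: [a1, b1] :: [a3, b3] :: [a2, b2] :: r3) :=
    P.trans (((List.Perm.swap _ _ _).cons _).cons _)
  have P23 : M.Perm ([u, v] :: [a2, b2] :: [a3, b3] :: [a1, b1] :: r3) := by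
    refine P.trans (List.Perm.cons _ ?_)
    exact (List.Perm.swap _ _ _).trans (((List.Perm.swap _ _ _)).cons _)
  have H1 := fun h => D.nobow P h
  have H2 := fun h => D.nobow P13 h
  have H3 := fun h => D.nobow P23 h
  by_cases y1 : 2 ≤ dg R u [a1, b1] <;> by_cases y2 : 2 ≤ dg R u [a2, b2] <;>
    by_cases y3 : 2 ≤ dg R u [a3, b3] <;> first
      | exact H1 (Or.inl ⟨by omega, by omega⟩)
      | exact H1 (Or.inr ⟨by omega, by omega⟩)
      | exact H2 (Or.inl ⟨by omega, by omega⟩)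
      | exact H2 (Or.inr ⟨by omega, by omega⟩)
      | exact H3 (Or.inl ⟨by omega, by omega⟩)
      | exact H3 (Or.inr ⟨by omega, by omega⟩)

theorem Dec.e_bound (D : Dec R B M I) {e : List V} (he : e ∈ M) :
    2 * R.minDegree ≤ (B.map (dE R e)).sum + 2 * M.length + I.length + 6 := by
  obtain ⟨s, t, hst⟩ := List.append_of_mem he
  have hM : M.Perm (e :: (s ++ t)) := by rw [hst]; exact List.perm_middle
  generalize s ++ t = M' at hM
  obtain ⟨u, v, rfl⟩ := len2 (D.hM e he).1
  have h1 := D.deg u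
  have h2 := D.deg v
  have h3 := D.uI hM
  have h4 := D.uM hM
  have hl := hM.length_eq
  rw [(hM.map (dg R u)).sum_eq] at h1
  rw [(hM.map (dg R v)).sum_eq] at h2
  simp only [List.map_cons, List.sum_cons, List.length_cons] at h1 h2 hl
  have e1 : (B.map (dE R [u, v])).sum = (B.map (dg R u)).sum + (B.map (dg R v)).sum := by
    rw [← List.sum_map_add]; simp only [← dE_two]
  have e2 : (M'.map (dE R [u, v])).sum = (M'.map (dg R u)).sum + (M'.map (dg R v)).sum := by
    rw [← List.sum_map_add]; simp only [← dE_two]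
  have h5 : dg R u [u, v] ≤ 1 := by
    simp [dg]; exact Bool.toNat_le _
  have h6 : dg R v [u, v] ≤ 1 := by
    simp [dg]; exact Bool.toNat_le _
  omega

end level


section final
variable {V : Type} [Fintype V] [DecidableEq V] {R : SimpleGraph V} [DecidableRel R.Adj]

theorem flat_perm4 {p x y z : List V} {rest N : List (List V)} (hN : St R N)
    (hp : N.Perm ([p, x, y, z] ++ rest)) : (p ++ x ++ y ++ z).Nodup := by
  have := ((St_append R).1 (St_perm R hp hN)).1.2
  simpa [List.append_assoc] using this

theorem no_found {p x y z : List V} {rest N : List (List V)} (hN : WMx R N)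
    (hp : N.Perm ([p, x, y, z] ++ rest)) (h1 : IsBow R p) (h2 : IsEdge R x) (h3 : IsEdge R y)
    (h4 : IsEdge R z) (hF : Found R (p ++ x ++ y ++ z) 13 100) : False := by
  obtain ⟨N', hS, hx, hW⟩ := hF
  have h := WMx_repl R hN hp hS (by
    intro v hv
    left
    have := hx v hv
    simpa [List.append_assoc, or_assoc] using this)
  have e : Wt [p, x, y, z] = 13 := by simp [Wt, wl, h1.1, h2.1, h3.1, h4.1]
  have := Hq_le_Wt N'
  omega

def spl : List V → List (List V)
  | [a, b, c, d] => [[a, b], [c, d]]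
  | _ => []

def QP (e f : List V) : Prop := ∃ a b c d, e = [a, b] ∧ f = [c, d] ∧ IsQuad R [a, b, c, d]

theorem QP.edges {e f : List V} (h : QP (R := R) e f) : IsEdge R e ∧ IsEdge R f := by
  obtain ⟨a, b, c, d, rfl, rfl, h⟩ := h
  exact split_quad R h

theorem quad_rep {D : List V} (hD : IsQuad R D) (p : List V) : ∃ e f, (spl D).Perm [e, f] ∧
    QP (R := R) e f ∧ dE R f p ≤ dE R e p ∧ dE R D p = dE R e p + dE R f p := by
  obtain ⟨a, b, c, d, rfl⟩ := len4 hD.1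
  have e0 : dE R [a, b, c, d] p = dE R [a, b] p + dE R [c, d] p := dE_append R [a, b] [c, d] p
  rcases le_total (dE R [c, d] p) (dE R [a, b] p) with h | h
  · exact ⟨[a, b], [c, d], List.Perm.refl _, ⟨a, b, c, d, rfl, rfl, hD⟩, h, e0⟩
  · refine ⟨[c, d], [a, b], List.Perm.swap _ _ _, ⟨c, d, a, b, rfl, rfl, ?_⟩, h, by omega⟩
    obtain ⟨h1, h2, h3, h4, h5⟩ := quad_adj R hD
    refine ⟨rfl, rfl, ?_⟩
    intro q hq
    simp only [ppairs, List.mem_cons, List.not_mem_nil, or_false] at hq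
    rcases hq with rfl | rfl | rfl | rfl | rfl
    · exact h2
    · exact h1
    · exact h3.symm
    · exact h5.symm
    · exact h4.symm

theorem exists_split : ∃ (B Q E : List (List V)) (I : List V), (∀ p ∈ B, IsBow R p) ∧
    (∀ p ∈ Q, IsQuad R p) ∧ (∀ p ∈ E, IsEdge R p) ∧ Mx R (B ++ Q ++ E) ∧
    Dec R B (E ++ Q.flatMap spl) I := by
  obtain ⟨N, hN⟩ := exists_Mx R
  let B := N.filter fun p => p.length == 5
  let Q := (N.filter fun p => !(p.length == 5)).filter fun p => p.length == 4
  let E := (N.filter fun p => !(p.length == 5)).filter fun p => !(p.length == 4)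
  have hP : N.Perm (B ++ Q ++ E) := by
    refine (List.filter_append_perm (fun p => p.length == 5) N).symm.trans ?_
    rw [List.append_assoc]
    exact List.Perm.append_left _ (List.filter_append_perm _ _).symm
  have hB : ∀ p ∈ B, IsBow R p := by
    intro p hp
    simp only [B, List.mem_filter, beq_iff_eq] at hp
    exact ⟨hp.2, hN.1.1 p hp.1⟩
  have hQ : ∀ p ∈ Q, IsQuad R p := by
    intro p hp
    simp only [Q, List.mem_filter, beq_iff_eq] at hp
    exact ⟨hp.2, hN.1.1 p hp.1.1⟩
  have hE : ∀ p ∈ E, IsEdge R p := by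
    intro p hp
    simp only [E, List.mem_filter] at hp
    have h := hN.1.1 p hp.1.1
    have h' := h.1
    simp [lenok] at h' hp
    exact ⟨by tauto, h⟩
  have hMx : Mx R (B ++ Q ++ E) := by
    refine ⟨St_perm R hP hN.1, ?_⟩
    rw [← Wt_perm hP, ← Hq_perm hP]
    exact hN.2
  clear_value B Q E
  have hfl : (Q.flatMap spl).flatten = Q.flatten := by
    clear hP hMx
    induction Q with
    | nil => rfl
    | cons D Q ih =>
      obtain ⟨a, b, c, d, rfl⟩ := len4 (hQ D (by simp)).1
      rw [List.flatMap_cons, List.flatten_append, ih (fun p hp => hQ p (by simp [hp]))]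
      simp [spl]
  have hW : Wt (Q.flatMap spl) = Wt Q := by
    clear hP hMx hfl
    induction Q with
    | nil => rfl
    | cons D Q ih =>
      obtain ⟨a, b, c, d, rfl⟩ := len4 (hQ D (by simp)).1
      rw [List.flatMap_cons, Wt_append, ih (fun p hp => hQ p (by simp [hp]))]
      simp [spl, Wt, wl]
  have hsE : ∀ p ∈ Q.flatMap spl, IsEdge R p := by
    intro p hp
    rw [List.mem_flatMap] at hp
    obtain ⟨D, hD, hp⟩ := hp
    obtain ⟨a, b, c, d, rfl⟩ := len4 (hQ D hD).1
    have := split_quad R (hQ _ hD)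
    simp [spl] at hp
    rcases hp with rfl | rfl
    · exact this.1
    · exact this.2
  have hM : ∀ p ∈ E ++ Q.flatMap spl, IsEdge R p := by
    intro p hp
    rw [List.mem_append] at hp
    exact hp.elim (hE p) (hsE p)
  have hst : St R (B ++ (E ++ Q.flatMap spl)) := by
    refine ⟨?_, ?_⟩
    · intro p hp
      rw [List.mem_append] at hp
      exact hp.elim (fun h => (hB p h).2) (fun h => (hM p h).2)
    · have h := hMx.1.2
      have hp : (B ++ Q ++ E).flatten.Perm (B ++ (E ++ Q.flatMap spl)).flatten := by
        simp only [List.flatten_append, hfl, List.append_assoc]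
        exact List.Perm.append_left _ List.perm_append_comm
      exact hp.nodup_iff.1 h
  refine ⟨B, Q, E, (Finset.univ : Finset V).toList.filter
    (fun x => !decide (x ∈ B.flatten ++ (E ++ Q.flatMap spl).flatten)), hB, hQ, hE, hMx,
    ⟨hB, hM, ⟨hst, ?_⟩, ?_, ?_⟩⟩
  · intro N' hN'
    have := (hMx.2 N' hN').1
    simp only [Wt_append, hW] at this ⊢
    omega
  · rw [List.nodup_append']
    refine ⟨by simpa using hst.2, (Finset.nodup_toList _).filter _, ?_⟩
    intro x hx hx'
    rw [List.mem_filter] at hx'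
    simp only [hx] at hx'
    simp at hx'
  · intro x
    rw [List.mem_append, List.mem_filter]
    by_cases h : x ∈ B.flatten ++ (E ++ Q.flatMap spl).flatten
    · exact Or.inl h
    · right; simp only [h]; simp

theorem flat_len {n : ℕ} (L : List (List V)) (h : ∀ p ∈ L, p.length = n) :
    L.flatten.length = n * L.length := by
  induction L with
  | nil => simp
  | cons p L ih =>
    rw [List.flatten_cons, List.length_append, ih fun q hq => h q (by simp [hq]), h p (by simp),
      List.length_cons, Nat.mul_add]; omega

theorem spl_len (Q : List (List V)) (hQ : ∀ p ∈ Q, IsQuad R p) :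
    (Q.flatMap spl).length = 2 * Q.length := by
  induction Q with
  | nil => rfl
  | cons D Q ih =>
    obtain ⟨a, b, c, d, rfl⟩ := len4 (hQ D (by simp)).1
    rw [List.flatMap_cons, List.length_append, ih (fun p hp => hQ p (by simp [hp]))]
    simp [spl]; omega

/-- choose a bowtie on which the total of `f` over the members of `X` is large -/
theorem pick_bow {α : Type} (f : α → List V → ℕ) (X : List α) (B : List (List V)) (c : ℕ)
    (hX : 0 < X.length) (h : ∀ x ∈ X, c * B.length + 1 ≤ (B.map (f x)).sum) :
    ∃ p r, B.Perm (p :: r) ∧ X.length * c < (X.map fun x => f x p).sum := by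
  have h1 := sum_lb (fun x => (B.map (f x)).sum) (c * B.length + 1) X h
  rw [sum_swap] at h1
  obtain ⟨p, r, k1, k2, -, -⟩ := pick (fun p => (X.map fun x => f x p).sum) (X.length * c) B (by
    refine lt_of_lt_of_le ?_ h1
    rw [mul_assoc]
    exact Nat.mul_lt_mul_of_pos_left (Nat.lt_succ_self _) hX)
  exact ⟨p, r, k1, k2⟩

theorem main_bound (hδ : 5 * R.minDegree ≤ 3 * Fintype.card V) :
    ∃ B : List (List V), (∀ p ∈ B, IsBow R p) ∧ B.flatten.Nodup ∧
      2 * R.minDegree ≤ Fintype.card V + B.length + 100 := by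
  obtain ⟨B, Q, E, I, hB, hQ, hE, hMx, D⟩ := exists_split (R := R)
  refine ⟨B, hB, ?_, ?_⟩
  · exact (List.nodup_append'.1 (List.nodup_append'.1 D.nd).1).1
  by_contra hlt
  have hk : Fintype.card V = 5 * B.length + 2 * (E.length + 2 * Q.length) + I.length := by
    have h1 : (B.flatten ++ (E ++ Q.flatMap spl).flatten ++ I).length = Fintype.card V := by
      rw [← List.toFinset_card_of_nodup D.nd, ← Finset.card_univ]
      congr 1
      ext x; simpa using D.all x
    rw [List.length_append, List.length_append, flat_len B fun p hp => (hB p hp).1,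
      flat_len (E ++ Q.flatMap spl) fun p hp => (D.hM p hp).1, List.length_append,
      spl_len Q hQ] at h1
    omega
  have hMl : (E ++ Q.flatMap spl).length = E.length + 2 * Q.length := by
    rw [List.length_append, spl_len Q hQ]
  have eB : ∀ e ∈ E ++ Q.flatMap spl, 6 * B.length + 1 ≤ (B.map (dE R e)).sum := by
    intro e he
    have := D.e_bound he
    rw [hMl] at this
    omega
  have hI : I.Nodup := (List.nodup_append'.1 D.nd).2.1
  -- uncovered vertices
  have I5 : I.length ≤ 5 := by
    by_contra hc
    have hX : (I.take 6).length = 6 := by rw [List.length_take]; omega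
    have hsub : ∀ x ∈ I.take 6, x ∈ I := fun x hx => List.mem_of_mem_take hx
    have hXnd : (I.take 6).Nodup := (List.take_sublist 6 I).nodup hI
    generalize I.take 6 = X at hX hsub hXnd
    obtain ⟨p, r, hp, hs⟩ := pick_bow (dg R) X B 3 (by omega) (by
      intro x hx
      have := D.x_bound (hsub x hx)
      rw [hMl] at this
      omega)
    have hbp := hB p (hp.mem_iff.2 (by simp))
    have cap : ∀ x, dg R x p ≤ 5 := fun x => by have := dg_le R x p; rwa [hbp.1] at this
    obtain ⟨x, r1, k1, k2, k3, k4⟩ := pick (fun x => dg R x p) 3 X (by omega)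
    have cx := cap x
    try simp only at k2 k4
    obtain ⟨y, r2, m1, m2, m3, m4⟩ := pick (fun x => dg R x p) 2 r1 (by omega)
    have cy := cap y
    try simp only at m2 m4
    obtain ⟨z, r3, n1, n2, n3, n4⟩ := pick (fun x => dg R x p) 2 r2 (by omega)
    have P : X.Perm ([x, y, z] ++ r3) := k1.trans ((m1.trans (n1.cons _)).cons _)
    have hxyz : ∀ v ∈ [x, y, z], v ∈ I := fun v hv => hsub v (P.mem_iff.2 (by
      rw [List.mem_append]; exact Or.inl hv))
    have hBM : (B ++ (E ++ Q.flatMap spl)).Perm ([p] ++ (r ++ (E ++ Q.flatMap spl))) :=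
      hp.append_right _
    have hpn : p.Nodup := by
      have := ((St_append R).1 (St_perm R hBM D.mx.1)).1.2
      simpa using this
    have hnd : (p ++ [x, y, z]).Nodup := by
      rw [List.nodup_append']
      refine ⟨hpn, (List.nodup_append'.1 (P.nodup_iff.1 hXnd)).1, ?_⟩
      intro v hv hv'
      refine D.notMem (hxyz v hv') ?_
      rw [hBM.flatten.mem_iff]
      simp [hv]
    obtain ⟨N', hS, hx, hW⟩ := FLB R hbp x y z hnd k2 m2 n2
    have h := WMx_repl R D.mx hBM hS (by
      intro v hv
      have := hx v hv
      rw [List.mem_append] at this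
      rcases this with h | h
      · left; simpa using h
      · exact Or.inr (D.notMem (hxyz v h)))
    have e : Wt [p] = 7 := by simp [Wt, wl, hbp.1]
    have := Hq_le_Wt N'
    omega
  -- edges
  have E9 : E.length ≤ 9 := by
    by_contra hc
    have hX : (E.take 10).length = 10 := by rw [List.length_take]; omega
    have hsplit := List.take_append_drop 10 E
    generalize E.take 10 = X at hX hsplit
    generalize E.drop 10 = X' at hsplit
    subst hsplit
    obtain ⟨p, r, hp, hs⟩ := pick_bow (dE R) X B 6 (by omega) (by
      intro x hx
      exact eB x (by simp [hx]))
    have hbp := hB p (hp.mem_iff.2 (by simp))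
    have cap : ∀ x ∈ X, dE R x p ≤ 10 := fun x hx => by
      have := dE_le R x p; rwa [hbp.1, (hE x (by simp [hx])).1] at this
    obtain ⟨x, r1, k1, k2, k3, k4⟩ := pick (fun x => dE R x p) 6 X (by omega)
    have cx := cap x (k1.mem_iff.2 (by simp))
    try simp only at k2 k4
    obtain ⟨y, r2, m1, m2, m3, m4⟩ := pick (fun x => dE R x p) 5 r1 (by omega)
    have cy := cap y (k1.mem_iff.2 (by simp [m1.mem_iff]))
    try simp only at m2 m4
    obtain ⟨z, r3, n1, n2, n3, n4⟩ := pick (fun x => dE R x p) 5 r2 (by omega)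
    have P : X.Perm ([x, y, z] ++ r3) := k1.trans ((m1.trans (n1.cons _)).cons _)
    have hx1 := hE x (by simp [P.mem_iff])
    have hy1 := hE y (by simp [P.mem_iff])
    have hz1 := hE z (by simp [P.mem_iff])
    have hN : (B ++ Q ++ (X ++ X')).Perm ([p, x, y, z] ++ (r3 ++ (X' ++ (r ++ Q)))) := by
      have h1 : (B ++ Q ++ (X ++ X')).Perm ((p :: r) ++ Q ++ (([x, y, z] ++ r3) ++ X')) :=
        (hp.append_right Q).append (P.append_right X')
      refine h1.trans ?_
      rw [List.cons_append, List.cons_append, List.cons_append]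
      refine List.Perm.cons _ (List.perm_append_comm.trans ?_)
      simp
    have hnd := flat_perm4 hMx.1 hN
    obtain ⟨N', hS, hx, hW⟩ := FL1 R hbp hx1 hy1 hz1 hnd k2 m2 n2
    have h := Mx_repl R hMx hN hS (by
      intro v hv
      left
      have := hx v hv
      simpa [List.append_assoc, or_assoc] using this)
    have e : Wt [p, x, y, z] = 13 := by simp [Wt, wl, hbp.1, hx1.1, hy1.1, hz1.1]
    have e' : Hq [p, x, y, z] = 0 := by simp [Hq, hl, hbp.1, hx1.1, hy1.1, hz1.1]
    rcases hW with hW | hW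
    · omega
    · have := h.2 (by omega)
      omega
  -- quads
  have Q17 : Q.length ≤ 17 := by
    by_contra hc
    have hX : (Q.take 18).length = 18 := by rw [List.length_take]; omega
    have hsplit := List.take_append_drop 18 Q
    generalize Q.take 18 = X at hX hsplit
    generalize Q.drop 18 = X' at hsplit
    subst hsplit
    obtain ⟨p, r, hp, hs⟩ := pick_bow (dE R) X B 12 (by omega) (by
      intro x hx
      have hq := hQ x (by simp [hx])
      obtain ⟨a, b, c, d, rfl⟩ := len4 hq.1
      have hin : ∀ e ∈ spl [a, b, c, d], e ∈ E ++ (X ++ X').flatMap spl := by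
        intro e he
        rw [List.mem_append, List.mem_flatMap]
        exact Or.inr ⟨_, by simp [hx], he⟩
      have h1 := eB [a, b] (hin _ (by simp [spl]))
      have h2 := eB [c, d] (hin _ (by simp [spl]))
      have e0 : (B.map (dE R [a, b, c, d])).sum =
          (B.map (dE R [a, b])).sum + (B.map (dE R [c, d])).sum := by
        rw [← List.sum_map_add]
        congr 1
        apply List.map_congr_left
        intro p _
        exact dE_append R [a, b] [c, d] p
      omega)
    have hbp := hB p (hp.mem_iff.2 (by simp))
    have cap : ∀ x ∈ X, dE R x p ≤ 20 := fun x hx => by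
      have := dE_le R x p; rwa [hbp.1, (hQ x (by simp [hx])).1] at this
    obtain ⟨x, r1, k1, k2, k3, k4⟩ := pick (fun x => dE R x p) 12 X (by omega)
    have cx := cap x (k1.mem_iff.2 (by simp))
    try simp only at k2 k4
    obtain ⟨y, r2, m1, m2, m3, m4⟩ := pick (fun x => dE R x p) 11 r1 (by omega)
    have cy := cap y (k1.mem_iff.2 (by simp [m1.mem_iff]))
    try simp only at m2 m4
    obtain ⟨z, r3, n1, n2, n3, n4⟩ := pick (fun x => dE R x p) 11 r2 (by omega)
    try simp only at n2
    have P : X.Perm ([x, y, z] ++ r3) := k1.trans ((m1.trans (n1.cons _)).cons _)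
    have hx1 := hQ x (by simp [P.mem_iff])
    have hy1 := hQ y (by simp [P.mem_iff])
    have hz1 := hQ z (by simp [P.mem_iff])
    obtain ⟨e, e', pe, qe, le1, se⟩ := quad_rep hx1 p
    obtain ⟨f, f', pf, qf, lf1, sf⟩ := quad_rep hy1 p
    obtain ⟨g, g', pg, qg, lg1, sg⟩ := quad_rep hz1 p
    let S : List (List V) := r ++ (E ++ ((r3 ++ X').flatMap spl))
    have hN : (B ++ (E ++ (X ++ X').flatMap spl)).Perm
        (p :: e :: e' :: f :: f' :: g :: g' :: S) := by
      have h2 : ((X ++ X').flatMap spl).Perm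
          (e :: e' :: f :: f' :: g :: g' :: ((r3 ++ X').flatMap spl)) := by
        refine ((P.append_right X').flatMap_right spl).trans ?_
        have : ([x, y, z] ++ r3 ++ X').flatMap spl =
          spl x ++ (spl y ++ (spl z ++ (r3 ++ X').flatMap spl)) := by simp
        rw [this]
        exact pe.append (pf.append (pg.append_right _))
      have h3 := hp.append (h2.append_left E)
      refine h3.trans ?_
      rw [List.cons_append]
      refine List.Perm.cons _ ?_
      have : ∀ (L T : List (List V)), (r ++ (E ++ (L ++ T))).Perm (L ++ (r ++ (E ++ T))) := by
        intro L T
        rw [← List.append_assoc r E, ← List.append_assoc r E]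
        exact List.perm_append_comm_assoc _ _ _
      exact this [e, e', f, f', g, g'] _
    by_cases c1 : 6 ≤ dE R e' p
    · have hN1 : (B ++ (E ++ (X ++ X').flatMap spl)).Perm ([p, e, e', f] ++ (f' :: g :: g' :: S)) := hN
      have hnd := flat_perm4 D.mx.1 hN1
      refine no_found D.mx hN1 hbp qe.edges.1 qe.edges.2 qf.edges.1 ?_
      obtain ⟨a, b, c, d, rfl, rfl, hq⟩ := qe
      exact FL4 R hbp hq qf.edges.1 hnd (by omega) c1 (by omega)
    have e8 : 8 ≤ dE R e p := by omega
    by_cases c2 : 6 ≤ dE R f' p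
    · have hN1 : (B ++ (E ++ (X ++ X').flatMap spl)).Perm ([p, e, f, f'] ++ (e' :: g :: g' :: S)) := by
        refine hN.trans (((?_ : List.Perm _ _).cons _).cons _)
        exact List.perm_middle (l₁ := [f, f']) |>.symm
      have hnd := flat_perm4 D.mx.1 hN1
      refine no_found D.mx hN1 hbp qe.edges.1 qf.edges.1 qf.edges.2 ?_
      have he := qe.edges.1
      obtain ⟨a, b, c, d, rfl, rfl, hq⟩ := qf
      exact FL5 R hbp he hq hnd e8 (by omega) c2
    by_cases c3 : 6 ≤ dE R g' p
    · have hN1 : (B ++ (E ++ (X ++ X').flatMap spl)).Perm ([p, e, g, g'] ++ (e' :: f :: f' :: S)) := by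
        refine hN.trans (((?_ : List.Perm _ _).cons _).cons _)
        exact List.perm_append_comm_assoc [e', f, f'] [g, g'] S
      have hnd := flat_perm4 D.mx.1 hN1
      refine no_found D.mx hN1 hbp qe.edges.1 qg.edges.1 qg.edges.2 ?_
      have he := qe.edges.1
      obtain ⟨a, b, c, d, rfl, rfl, hq⟩ := qg
      exact FL5 R hbp he hq hnd e8 (by omega) c3
    have hN1 : (B ++ (E ++ (X ++ X').flatMap spl)).Perm ([p, e, f, g] ++ (e' :: f' :: g' :: S)) := by
      refine hN.trans (((?_ : List.Perm _ _).cons _).cons _)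
      refine (List.Perm.swap _ _ _).trans (List.Perm.cons _ ?_)
      exact List.perm_append_comm_assoc [e', f'] [g] (g' :: S)
    have hnd := flat_perm4 D.mx.1 hN1
    exact no_found D.mx hN1 hbp qe.edges.1 qf.edges.1 qg.edges.1
      (FL2 R hbp qe.edges.1 qf.edges.1 qg.edges.1 hnd (by omega) (by omega) (by omega))
  omega

end final

end BT

/-- there is a constant `C` (depending only on `F₂`) such that every graph `R`
on `k` vertices with `δ(R) ≤ (3/5)k` contains at least `2δ(R) - k - C` pairwise
vertex-disjoint copies of the bowtie `F₂`. -/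
theorem stmt3 :
    ∃ C : ℝ, ∀ (V : Type) [Fintype V] [DecidableEq V] (R : SimpleGraph V)
      [DecidableRel R.Adj],
      (R.minDegree : ℝ) ≤ (3 / 5) * Fintype.card V →
      ∃ 𝒯 : Finset (Fin 5 ↪ V),
        (∀ e ∈ 𝒯, ∀ a b : Fin 5, Bowtie.Adj a b → R.Adj (e a) (e b)) ∧
        (∀ e ∈ 𝒯, ∀ f ∈ 𝒯, e ≠ f → ∀ a b : Fin 5, e a ≠ f b) ∧
        2 * (R.minDegree : ℝ) - Fintype.card V - C ≤ 𝒯.card := by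
  refine ⟨100, ?_⟩
  intro V _ _ R _ h
  have h' : 5 * R.minDegree ≤ 3 * Fintype.card V := by
    have : (5 : ℝ) * R.minDegree ≤ 3 * Fintype.card V := by linarith
    exact_mod_cast this
  obtain ⟨B, hB, hnd, hb⟩ := BT.main_bound h'
  obtain ⟨T, h1, h2, -, h4⟩ := BT.to_emb R B hB hnd
  refine ⟨T, h1, h2, ?_⟩
  rw [h4]
  have : (2 : ℝ) * R.minDegree ≤ Fintype.card V + B.length + 100 := by exact_mod_cast hb
  linarith
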